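/- arXiv:2003.11537 — 2 statements merged into one kernel-verified Lean document; each statement's English description precedes it below -/
import Mathlib

section
/- Let Y, ψ be integrable real random variables and X a random vector in ℝ^{d_X}, with (Y, X) and (ψ, X) defined on (possibly different) probability spaces. The following are equivalent: (i) there exist, on some probability space, random variables (Y', ψ', X') such that (Y', X') has the same joint distribution as (Y, X), (ψ', X') has the same joint distribution as (ψ, X), and E[Y' | σ(ψ', X')] = ψ' almost surely; (ii) almost surely, E[(y − Y)⁺ | X] − E[(y − ψ)⁺ | X] ≥ 0 for all y ∈ ℝ, and E[Y | X] = E[ψ | X] almost surely. Moreover, if (i) holds, then H₀ holds as well. -/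
open MeasureTheory ProbabilityTheory

/-- H₀ realized on a given probability space `(Ω, P)`. -/
def H0On (Ω : Type) [mΩ : MeasurableSpace Ω] (P : Measure Ω) (μY μψ : Measure ℝ) : Prop :=
  IsProbabilityMeasure P ∧
    ∃ Y' ψ' : Ω → ℝ,
      Measurable Y' ∧ Measurable ψ' ∧
      P.map Y' = μY ∧ P.map ψ' = μψ ∧
      ∃ I' : MeasurableSpace Ω,
        I' ≤ mΩ ∧
        MeasurableSpace.comap ψ' Real.measurableSpace ≤ I' ∧
        P[Y' | I'] =ᵐ[P] ψ'

/-- H₀ (rationalizing rational expectations) for a pair of marginal distributions. -/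
def H0 (μY μψ : Measure ℝ) : Prop :=
  ∃ (Ω : Type) (mΩ : MeasurableSpace Ω) (P : @Measure Ω mΩ), @H0On Ω mΩ P μY μψ

/-- H₀X realized on a given probability space: there are `(Y', ψ', X')` such that
`(Y', X')` and `(ψ', X')` have the prescribed joint distributions and
`E[Y' | σ(ψ', X')] = ψ'` almost surely. -/
def H0XOn (Ω : Type) [mΩ : MeasurableSpace Ω] (P : Measure Ω) (d : ℕ)
    (μYX μψX : Measure (ℝ × (Fin d → ℝ))) : Prop :=
  IsProbabilityMeasure P ∧
    ∃ (Y' ψ' : Ω → ℝ) (X' : Ω → Fin d → ℝ),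
      Measurable Y' ∧ Measurable ψ' ∧ Measurable X' ∧
      P.map (fun ω => (Y' ω, X' ω)) = μYX ∧
      P.map (fun ω => (ψ' ω, X' ω)) = μψX ∧
      P[Y' | MeasurableSpace.comap (fun ω => (ψ' ω, X' ω)) inferInstance] =ᵐ[P] ψ'

open Set Filter Topology
open scoped ENNReal

/-- The uniform distribution on the open unit interval, as a measure on `ℝ`. -/
noncomputable def uniformIoo : Measure ℝ := volume.restrict (Ioo 0 1)

instance : IsProbabilityMeasure uniformIoo := ⟨by simp [uniformIoo]⟩

lemma ae_mem_Ioo_uniformIoo : ∀ᵐ t ∂uniformIoo, t ∈ Ioo (0 : ℝ) 1 :=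
  ae_restrict_mem measurableSet_Ioo

lemma uniformIoo_Iic {a : ℝ} (h1 : a ≤ 1) :
    uniformIoo (Iic a) = ENNReal.ofReal a := by
  have h : (Iic a ∩ Ioo 0 1 : Set ℝ) =ᵐ[volume] Ioc 0 a := by
    rw [inter_comm]
    rcases h1.lt_or_eq with h1 | rfl
    · refine Eventually.of_forall fun t => propext ?_
      change (t ∈ Ioo 0 1 ∧ t ∈ Iic a) ↔ t ∈ Ioc 0 a
      grind
    · rw [inter_eq_left.2 fun t ht => ht.2.le]
      exact Ioo_ae_eq_Ioc
  rw [uniformIoo, Measure.restrict_apply measurableSet_Iic, measure_congr h, Real.volume_Ioc,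
    sub_zero]

open Classical in
/-- The left-continuous quantile function of a probability measure on `ℝ`, extended by `0` outside
the open unit interval. -/
noncomputable def quantile (μ : Measure ℝ) (t : ℝ) : ℝ :=
  if t ∈ Ioo (0 : ℝ) 1 then sInf {y | t ≤ cdf μ y} else 0

section quantile

variable {μ ν : Measure ℝ}

lemma quantile_le_iff {t y : ℝ} (ht : t ∈ Ioo (0 : ℝ) 1) : quantile μ t ≤ y ↔ t ≤ cdf μ y := by
  have hne : {y | t ≤ cdf μ y}.Nonempty := by
    obtain ⟨y, hy⟩ := ((tendsto_cdf_atTop μ).eventually (lt_mem_nhds ht.2)).exists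
    exact ⟨y, hy.le⟩
  have hbdd : BddBelow {y | t ≤ cdf μ y} := by
    obtain ⟨b, hb⟩ := ((tendsto_cdf_atBot μ).eventually (gt_mem_nhds ht.1)).exists
    refine ⟨b, fun y hy => le_of_not_gt fun hyb => ?_⟩
    exact absurd ((hb.trans_le hy).trans_le (monotone_cdf μ hyb.le)) (lt_irrefl _)
  rw [quantile, if_pos ht]
  constructor
  · intro h
    have hc := (cdf μ).right_continuous y
    have hc' : Tendsto (cdf μ) (𝓝[>] y) (𝓝 (cdf μ y)) :=
      tendsto_nhdsWithin_mono_left Ioi_subset_Ici_self hc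
    refine ge_of_tendsto hc' (eventually_nhdsWithin_of_forall fun z hz => ?_)
    obtain ⟨w, hw, hwz⟩ := exists_lt_of_csInf_lt hne (h.trans_lt hz)
    exact le_trans hw (monotone_cdf μ hwz.le)
  · exact fun h => csInf_le hbdd h

lemma monotoneOn_quantile : MonotoneOn (quantile μ) (Ioo 0 1) := fun _ hs _ ht hst =>
  (quantile_le_iff hs).2 (hst.trans ((quantile_le_iff ht).1 le_rfl))

lemma quantile_le_quantile (h : ∀ r : ℚ, cdf ν r ≤ cdf μ r) {t : ℝ} (ht : t ∈ Ioo (0 : ℝ) 1) :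
    quantile μ t ≤ quantile ν t := by
  refine le_of_forall_gt_imp_ge_of_dense fun y hy => ?_
  obtain ⟨r, hr, hry⟩ := exists_rat_btwn hy
  exact ((quantile_le_iff ht).2 (((quantile_le_iff ht).1 hr.le).trans (h r))).trans hry.le

variable {E : Type*} [MeasurableSpace E]

lemma measurable_quantile (κ : Kernel E ℝ) [IsMarkovKernel κ] :
    Measurable fun z : E × ℝ => quantile (κ z.1) z.2 := by
  refine measurable_of_Iic fun y => ?_
  have hm : MeasurableSet {z : E × ℝ | z.2 ∈ Ioo (0 : ℝ) 1} := measurable_snd measurableSet_Ioo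
  have hc : MeasurableSet {z : E × ℝ | z.2 ≤ cdf (κ z.1) y} := by
    simp_rw [cdf_eq_real]
    have : Measurable fun x => (κ x).real (Iic y) :=
      (κ.measurable_coe measurableSet_Iic).ennreal_toReal
    exact measurableSet_le measurable_snd (this.comp measurable_fst)
  have : (fun z : E × ℝ => quantile (κ z.1) z.2) ⁻¹' Iic y =
      {z | z.2 ∈ Ioo (0 : ℝ) 1}.ite {z | z.2 ≤ cdf (κ z.1) y} {_z | 0 ≤ y} := by
    ext z
    by_cases hz : z.2 ∈ Ioo (0 : ℝ) 1
    · have := quantile_le_iff (μ := κ z.1) (y := y) hz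
      simp_all [Set.ite]
    · have : quantile (κ z.1) z.2 = 0 := if_neg hz
      simp_all [Set.ite]
  rw [this]
  exact hm.ite hc (MeasurableSet.const _)

lemma measurable_quantile_right (μ : Measure ℝ) [IsProbabilityMeasure μ] :
    Measurable (quantile μ) :=
  (measurable_quantile (Kernel.const Unit μ)).comp (measurable_prodMk_left (x := ()))

lemma map_quantile (μ : Measure ℝ) [IsProbabilityMeasure μ] :
    uniformIoo.map (quantile μ) = μ := by
  have hm := measurable_quantile_right μ
  have := Measure.isProbabilityMeasure_map (μ := uniformIoo) hm.aemeasurable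
  refine Measure.ext_of_Iic _ _ fun y => ?_
  rw [Measure.map_apply hm measurableSet_Iic, ← ofReal_cdf, ← uniformIoo_Iic (cdf_le_one μ y)]
  refine measure_congr ?_
  filter_upwards [ae_mem_Ioo_uniformIoo] with t ht
  exact propext (quantile_le_iff ht)

lemma map_prod_quantile (μ : Measure E) [SFinite μ] (κ : Kernel E ℝ) [IsMarkovKernel κ] :
    (μ.prod uniformIoo).map (fun z => (z.1, quantile (κ z.1) z.2)) = μ ⊗ₘ κ := by
  have hm := measurable_fst.prodMk (measurable_quantile κ)
  ext s hs
  rw [Measure.map_apply hm hs, Measure.prod_apply (hm hs), Measure.compProd_apply hs]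
  refine lintegral_congr fun x => ?_
  conv_rhs => rw [← map_quantile (κ x)]
  rw [Measure.map_apply (measurable_quantile_right (κ x))
    (measurable_prodMk_left hs)]
  rfl

end quantile

/-- Two finite measures on `E × ℝ` with the same first marginal which are ordered by conditional
first-order stochastic dominance admit a coupling over `E` that is monotone in the second
coordinates. -/
lemma exists_monotone_coupling {E : Type*} [MeasurableSpace E] (α β : Measure (E × ℝ))
    [IsFiniteMeasure α] [IsFiniteMeasure β] (hfst : α.fst = β.fst)
    (hle : ∀ A : Set E, MeasurableSet A → ∀ r : ℚ, β (A ×ˢ Iic (r : ℝ)) ≤ α (A ×ˢ Iic (r : ℝ))) :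
    ∃ Q : Measure (E × ℝ × ℝ), Q.map (fun z => (z.1, z.2.1)) = α ∧
      Q.map (fun z => (z.1, z.2.2)) = β ∧ ∀ᵐ z ∂Q, z.2.1 ≤ z.2.2 := by
  have hmα := measurable_quantile α.condKernel
  have hmβ := measurable_quantile β.condKernel
  have hm := measurable_fst.prodMk (hmα.prodMk hmβ)
  refine ⟨(α.fst.prod uniformIoo).map fun z =>
    (z.1, quantile (α.condKernel z.1) z.2, quantile (β.condKernel z.1) z.2), ?_, ?_, ?_⟩
  · rw [Measure.map_map (by fun_prop) hm]
    refine (map_prod_quantile α.fst α.condKernel).trans ?_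
    exact α.disintegrate α.condKernel
  · rw [Measure.map_map (by fun_prop) hm, hfst]
    refine (map_prod_quantile β.fst β.condKernel).trans ?_
    exact β.disintegrate β.condKernel
  · rw [ae_map_iff hm.aemeasurable (measurableSet_le (by fun_prop) (by fun_prop))]
    have hcdf : ∀ᵐ x ∂α.fst, ∀ r : ℚ, cdf (β.condKernel x) r ≤ cdf (α.condKernel x) r := by
      rw [ae_all_iff]
      intro r
      have : (fun x => β.condKernel x (Iic (r : ℝ))) ≤ᵐ[α.fst]
          fun x => α.condKernel x (Iic (r : ℝ)) := by
        refine ae_le_of_forall_setLIntegral_le_of_sigmaFinite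
          (Kernel.measurable_coe _ measurableSet_Iic) fun s hs _ => ?_
        rw [Measure.setLIntegral_condKernel_eq_measure_prod hs measurableSet_Iic, hfst,
          Measure.setLIntegral_condKernel_eq_measure_prod hs measurableSet_Iic]
        exact hle s hs r
      filter_upwards [this] with x hx
      rw [cdf_eq_real, cdf_eq_real]
      exact ENNReal.toReal_mono (measure_ne_top _ _) hx
    have h1 : ∀ᵐ z ∂α.fst.prod uniformIoo, ∀ r : ℚ,
        cdf (β.condKernel z.1) r ≤ cdf (α.condKernel z.1) r :=
      Measure.quasiMeasurePreserving_fst.ae hcdf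
    have h2 : ∀ᵐ z ∂α.fst.prod uniformIoo, z.2 ∈ Ioo (0 : ℝ) 1 :=
      Measure.quasiMeasurePreserving_snd.ae ae_mem_Ioo_uniformIoo
    filter_upwards [h1, h2] with z hz hz'
    exact quantile_le_quantile hz hz'

/-- If `p` and `q` are nondecreasing in the second coordinate and `q` is dominated by `p` in
integrated form, then there is a measure `S` on pairs of points `(x, u)`, `(x, v)` with
`q u < p u ≤ p v < q v` such that moving mass `S` from the first points to the second ones
contributes `(p - q)⁺` to the drift at the first points, and conversely `-(q - p)⁺` at the second
points. -/
lemma exists_exchange_measure {E : Type*} [MeasurableSpace E] (l : Measure (E × ℝ))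
    [IsFiniteMeasure l] {p q : E × ℝ → ℝ} (hp : Measurable p) (hq : Measurable q)
    (hpi : Integrable p l) (hqi : Integrable q l) {T : Set ℝ}
    (hlT : ∀ᵐ z ∂l, z.2 ∈ T) (hpm : ∀ x, MonotoneOn (fun t => p (x, t)) T)
    (hle : ∀ A : Set E, MeasurableSet A → ∀ r : ℚ,
      ∫ z in A ×ˢ Iic (r : ℝ), q z ∂l ≤ ∫ z in A ×ˢ Iic (r : ℝ), p z ∂l)
    (heq : ∀ A : Set E, MeasurableSet A →
      ∫ z in A ×ˢ univ, q z ∂l = ∫ z in A ×ˢ univ, p z ∂l) :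
    ∃ S : Measure (E × ℝ × ℝ),
      S.map (fun z => (z.1, z.2.1)) + S.map (fun z => (z.1, z.2.2)) ≤ l ∧
      ∀ b : E × ℝ → ℝ, Measurable b →
        ∫ z, b (z.1, z.2.1) * (q (z.1, z.2.2) - q (z.1, z.2.1)) ∂S =
          ∫ z, b z * max (p z - q z) 0 ∂l ∧
        ∫ z, b (z.1, z.2.2) * (q (z.1, z.2.2) - q (z.1, z.2.1)) ∂S =
          ∫ z, b z * max (q z - p z) 0 ∂l := by
  have hfi : Integrable (fun z => p z - q z) l := hpi.sub hqi
  have hgi : Integrable (fun z => q z - p z) l := hqi.sub hpi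
  set f : E × ℝ → ℝ≥0∞ := fun z => ENNReal.ofReal (p z - q z) with hf
  set g : E × ℝ → ℝ≥0∞ := fun z => ENNReal.ofReal (q z - p z) with hg
  have hfm : Measurable f := by fun_prop
  have hgm : Measurable g := by fun_prop
  have hfin : IsFiniteMeasure (l.withDensity f) :=
    isFiniteMeasure_withDensity_ofReal hfi.2
  have hgin : IsFiniteMeasure (l.withDensity g) :=
    isFiniteMeasure_withDensity_ofReal hgi.2
  have hdiff : ∀ s, MeasurableSet s → ∫ z in s, p z ∂l - ∫ z in s, q z ∂l =
      (l.withDensity f).real s - (l.withDensity g).real s := by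
    intro s hs
    rw [← integral_sub hpi.integrableOn hqi.integrableOn,
      integral_eq_lintegral_pos_part_sub_lintegral_neg_part hfi.integrableOn, measureReal_def,
      measureReal_def, withDensity_apply _ hs, withDensity_apply _ hs]
    simp [hf, hg]
  obtain ⟨Q, hQu, hQv, hQle⟩ := exists_monotone_coupling (l.withDensity f) (l.withDensity g)
    (by
      ext A hA
      rw [Measure.fst_apply hA, Measure.fst_apply hA, ← prod_univ]
      have := hdiff (A ×ˢ univ) (hA.prod .univ)
      rw [heq A hA, sub_self, eq_comm, sub_eq_zero] at this
      exact (measureReal_eq_measureReal_iff).1 this)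
    (by
      intro A hA r
      have := hdiff (A ×ˢ Iic (r : ℝ)) (hA.prod measurableSet_Iic)
      have h := hle A hA r
      rw [← ENNReal.toReal_le_toReal (measure_ne_top _ _) (measure_ne_top _ _)]
      simp only [measureReal_def] at this
      linarith)
  set u : E × ℝ × ℝ → E × ℝ := fun z => (z.1, z.2.1) with hu
  set v : E × ℝ × ℝ → E × ℝ := fun z => (z.1, z.2.2) with hv
  have hum : Measurable u := by fun_prop
  have hvm : Measurable v := by fun_prop
  have hu_ae : ∀ᵐ z ∂Q, q (u z) < p (u z) ∧ (u z).2 ∈ T := by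
    refine ae_of_ae_map hum.aemeasurable (p := fun z => q z < p z ∧ z.2 ∈ T) ?_
    rw [hQu, ae_withDensity_iff hfm]
    filter_upwards [hlT] with z hz h
    exact ⟨by simpa [hf] using h, hz⟩
  have hv_ae : ∀ᵐ z ∂Q, p (v z) < q (v z) ∧ (v z).2 ∈ T := by
    refine ae_of_ae_map hvm.aemeasurable (p := fun z => p z < q z ∧ z.2 ∈ T) ?_
    rw [hQv, ae_withDensity_iff hgm]
    filter_upwards [hlT] with z hz h
    exact ⟨by simpa [hg] using h, hz⟩
  have hord : ∀ᵐ z ∂Q, q (u z) < p (u z) ∧ p (u z) ≤ p (v z) ∧ p (v z) < q (v z) := by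
    filter_upwards [hu_ae, hv_ae, hQle] with z h1 h2 h3
    exact ⟨h1.1, hpm z.1 h1.2 h2.2 h3, h2.1⟩
  set gap : E × ℝ × ℝ → ℝ≥0∞ := fun z => ENNReal.ofReal (q (v z) - q (u z)) with hgap
  have hgapm : Measurable gap := by fun_prop
  set S := Q.withDensity gap⁻¹ with hS
  have hSQ : S ≪ Q := withDensity_absolutelyContinuous _ _
  have hQS : S.withDensity gap = Q := by
    rw [hS, ← withDensity_mul _ hgapm.inv hgapm]
    rw [← withDensity_one (μ := Q)]
    conv_lhs => rw [withDensity_one]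
    refine withDensity_congr_ae ?_
    filter_upwards [hord] with z hz
    simp only [Pi.mul_apply, Pi.inv_apply, Pi.one_apply]
    refine ENNReal.inv_mul_cancel ?_ ENNReal.ofReal_ne_top
    simp only [hgap, ne_eq, ENNReal.ofReal_eq_zero, not_le]
    linarith
  have hSu : S.map u ≤ l := by
    calc S.map u ≤ (Q.withDensity (f⁻¹ ∘ u)).map u := by
          refine Measure.map_mono (withDensity_mono ?_) hum
          filter_upwards [hord] with z hz
          simp only [Pi.inv_apply, Function.comp]
          exact ENNReal.inv_le_inv.2 (ENNReal.ofReal_le_ofReal (by linarith))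
      _ = (l.withDensity f).withDensity f⁻¹ := by
          rw [← hQu]
          ext s hs
          rw [Measure.map_apply hum hs, withDensity_apply _ (hum hs), withDensity_apply _ hs,
            setLIntegral_map hs hfm.inv hum]
          rfl
      _ ≤ l := withDensity_inv_same_le hfm.aemeasurable
  have hSv : S.map v ≤ l := by
    calc S.map v ≤ (Q.withDensity (g⁻¹ ∘ v)).map v := by
          refine Measure.map_mono (withDensity_mono ?_) hvm
          filter_upwards [hord] with z hz
          simp only [Pi.inv_apply, Function.comp]
          exact ENNReal.inv_le_inv.2 (ENNReal.ofReal_le_ofReal (by linarith))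
      _ = (l.withDensity g).withDensity g⁻¹ := by
          rw [← hQv]
          ext s hs
          rw [Measure.map_apply hvm hs, withDensity_apply _ (hvm hs), withDensity_apply _ hs,
            setLIntegral_map hs hgm.inv hvm]
          rfl
      _ ≤ l := withDensity_inv_same_le hgm.aemeasurable
  have hsum : S.map u + S.map v ≤ l := by
    refine Measure.le_iff.2 fun s hs => ?_
    have hD : MeasurableSet {z | q z < p z} := measurableSet_lt hq hp
    have h1 : S.map v (s ∩ {z | q z < p z}) = 0 := by
      rw [Measure.map_apply hvm (hs.inter hD)]
      refine measure_mono_null (t := {z | ¬ p (v z) < q (v z)})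
        (fun z hz => not_lt.2 hz.2.le) ?_
      exact hSQ (ae_iff.1 (hord.mono fun z hz => hz.2.2))
    have h2 : S.map u (s \ {z | q z < p z}) = 0 := by
      rw [Measure.map_apply hum (hs.diff hD)]
      refine measure_mono_null (t := {z | ¬ q (u z) < p (u z)}) (fun z hz => hz.2) ?_
      exact hSQ (ae_iff.1 (hord.mono fun z hz => hz.1))
    rw [Measure.add_apply, ← measure_inter_add_sdiff s hD,
      ← measure_inter_add_sdiff (μ := S.map v) s hD, ← measure_inter_add_sdiff (μ := l) s hD,
      h1, h2, add_zero, zero_add]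
    exact add_le_add (hSu _) (hSv _)
  refine ⟨S, hsum, fun b hbm => ?_⟩
  have hex : ∀ k : E × ℝ × ℝ → E × ℝ,
      ∫ z, b (k z) * (q (v z) - q (u z)) ∂S = ∫ z, b (k z) ∂Q := by
    intro k
    rw [← hQS, integral_withDensity_eq_integral_toReal_smul hgapm
      (Eventually.of_forall fun z => ENNReal.ofReal_lt_top)]
    refine integral_congr_ae ?_
    filter_upwards [hSQ.ae_le hord] with z hz
    simp only [hgap, smul_eq_mul]
    rw [ENNReal.toReal_ofReal (by linarith)]
    ring
  have hdens : ∀ {F : E × ℝ → ℝ}, Measurable F →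
      ∫ z, b z ∂l.withDensity (fun z => ENNReal.ofReal (F z)) = ∫ z, b z * max (F z) 0 ∂l := by
    intro F hF
    rw [integral_withDensity_eq_integral_toReal_smul (by fun_prop)
        (Eventually.of_forall fun z => ENNReal.ofReal_lt_top)]
    simp [ENNReal.toReal_ofReal', mul_comm]
  constructor
  · refine (hex u).trans ?_
    rw [← integral_map (f := b) hum.aemeasurable hbm.aestronglyMeasurable, hQu]
    exact hdens (hp.sub hq)
  · refine (hex v).trans ?_
    rw [← integral_map (f := b) hvm.aemeasurable hbm.aestronglyMeasurable, hQv]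
    exact hdens (hq.sub hp)

/-- Exchange construction: if `p` and `q` are nondecreasing in the second coordinate and `q` is
dominated by `p` in integrated form, then there is a martingale coupling over `E` of the laws of `p`
and `q`. Part of the mass at a point `u` with `q u < p u` is exchanged with the same amount of mass
at a point `v` to its right with `p v < q v`. -/
lemma exists_martingale_coupling_of_monotone {E : Type*} [MeasurableSpace E] (l : Measure (E × ℝ))
    [IsFiniteMeasure l] {p q : E × ℝ → ℝ} (hp : Measurable p) (hq : Measurable q)
    (hpi : Integrable p l) (hqi : Integrable q l) {T : Set ℝ}
    (hlT : ∀ᵐ z ∂l, z.2 ∈ T) (hpm : ∀ x, MonotoneOn (fun t => p (x, t)) T)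
    (hle : ∀ A : Set E, MeasurableSet A → ∀ r : ℚ,
      ∫ z in A ×ˢ Iic (r : ℝ), q z ∂l ≤ ∫ z in A ×ˢ Iic (r : ℝ), p z ∂l)
    (heq : ∀ A : Set E, MeasurableSet A →
      ∫ z in A ×ˢ univ, q z ∂l = ∫ z in A ×ˢ univ, p z ∂l) :
    ∃ π : Measure (ℝ × ℝ × E),
      π.map (fun w => (w.1, w.2.2)) = l.map (fun z => (p z, z.1)) ∧
      π.map (fun w => (w.2.1, w.2.2)) = l.map (fun z => (q z, z.1)) ∧
      ∀ B : Set (ℝ × E), MeasurableSet B →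
        ∫ w in {w | (w.1, w.2.2) ∈ B}, w.2.1 ∂π = ∫ w in {w | (w.1, w.2.2) ∈ B}, w.1 ∂π := by
  obtain ⟨S, hsum, hSb⟩ := exists_exchange_measure l hp hq hpi hqi hlT hpm hle heq
  set u : E × ℝ × ℝ → E × ℝ := fun z => (z.1, z.2.1) with hu
  set v : E × ℝ × ℝ → E × ℝ := fun z => (z.1, z.2.2) with hv
  have hum : Measurable u := by fun_prop
  have hvm : Measurable v := by fun_prop
  have hSu : S.map u ≤ l := (Measure.le_add_right le_rfl).trans hsum
  have hSv : S.map v ≤ l := (Measure.le_add_left le_rfl).trans hsum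
  have : IsFiniteMeasure (S.map u + S.map v) := isFiniteMeasure_of_le l hsum
  set τ := l - (S.map u + S.map v) with hτ
  have hτl : τ + (S.map u + S.map v) = l := Measure.sub_add_cancel_of_le hsum
  refine ⟨τ.map (fun z => (p z, q z, z.1)) +
    (S.map (fun z => (p (u z), q (v z), z.1)) + S.map (fun z => (p (v z), q (u z), z.1))),
    ?_, ?_, ?_⟩
  · rw [Measure.map_add _ _ (by fun_prop), Measure.map_add _ _ (by fun_prop),
      Measure.map_map (by fun_prop) (by fun_prop), Measure.map_map (by fun_prop) (by fun_prop),
      Measure.map_map (by fun_prop) (by fun_prop)]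
    conv_rhs => rw [← hτl, Measure.map_add _ _ (by fun_prop), Measure.map_add _ _ (by fun_prop),
      Measure.map_map (by fun_prop) (by fun_prop), Measure.map_map (by fun_prop) (by fun_prop)]
    rfl
  · rw [Measure.map_add _ _ (by fun_prop), Measure.map_add _ _ (by fun_prop),
      Measure.map_map (by fun_prop) (by fun_prop), Measure.map_map (by fun_prop) (by fun_prop),
      Measure.map_map (by fun_prop) (by fun_prop), add_comm (S.map _) (S.map _)]
    conv_rhs => rw [← hτl, Measure.map_add _ _ (by fun_prop), Measure.map_add _ _ (by fun_prop),
      Measure.map_map (by fun_prop) (by fun_prop), Measure.map_map (by fun_prop) (by fun_prop)]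
    rfl
  · intro B hB
    have hτle : τ ≤ l := Measure.sub_le
    have hpu : Integrable (fun z => p (u z)) S := (hpi.mono_measure hSu).comp_measurable hum
    have hpv : Integrable (fun z => p (v z)) S := (hpi.mono_measure hSv).comp_measurable hvm
    have hqu : Integrable (fun z => q (u z)) S := (hqi.mono_measure hSu).comp_measurable hum
    have hqv : Integrable (fun z => q (v z)) S := (hqi.mono_measure hSv).comp_measurable hvm
    set b : E × ℝ → ℝ := fun z => B.indicator 1 (p z, z.1) with hb
    have hBm : Measurable (B.indicator (1 : ℝ × E → ℝ)) := measurable_one.indicator hB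
    have hbm : Measurable b := hBm.comp (by fun_prop)
    have hb1 : ∀ z, ‖b z‖ ≤ 1 := fun z => (norm_indicator_le_norm_self _ _).trans (by simp)
    have hbi : ∀ {F : E × ℝ → ℝ} {m : Measure (E × ℝ)}, Integrable F m →
        Integrable (fun z => b z * F z) m := fun hF =>
      hF.bdd_mul (c := 1) hbm.aestronglyMeasurable (Eventually.of_forall hb1)
    have hB' : MeasurableSet {w : ℝ × ℝ × E | (w.1, w.2.2) ∈ B} :=
      (show Measurable fun w : ℝ × ℝ × E => (w.1, w.2.2) by fun_prop) hB
    have hπ : ∀ F : ℝ × ℝ × E → ℝ, Measurable F →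
        Integrable (fun z => F (p z, q z, z.1)) τ →
        Integrable (fun z => F (p (u z), q (v z), z.1)) S →
        Integrable (fun z => F (p (v z), q (u z), z.1)) S →
        ∫ w in {w | (w.1, w.2.2) ∈ B}, F w ∂(τ.map (fun z => (p z, q z, z.1)) +
          (S.map (fun z => (p (u z), q (v z), z.1)) + S.map (fun z => (p (v z), q (u z), z.1)))) =
        ∫ z, b z * F (p z, q z, z.1) ∂τ + (∫ z, b (u z) * F (p (u z), q (v z), z.1) ∂S +
          ∫ z, b (v z) * F (p (v z), q (u z), z.1) ∂S) := by
      intro F hF h1 h2 h3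
      have hFm : ∀ m : Measure (ℝ × ℝ × E), AEStronglyMeasurable F m :=
        fun m => hF.aestronglyMeasurable
      have i1 : Integrable F (τ.map (fun z => (p z, q z, z.1))) :=
        (integrable_map_measure (hFm _) (by fun_prop)).2 h1
      have i2 : Integrable F (S.map (fun z => (p (u z), q (v z), z.1))) :=
        (integrable_map_measure (hFm _) (by fun_prop)).2 h2
      have i3 : Integrable F (S.map (fun z => (p (v z), q (u z), z.1))) :=
        (integrable_map_measure (hFm _) (by fun_prop)).2 h3
      rw [← integral_indicator hB', integral_add_measure (i1.indicator hB')
        ((i2.indicator hB').add_measure (i3.indicator hB')),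
        integral_add_measure (i2.indicator hB') (i3.indicator hB'),
        integral_map (by fun_prop) (hF.indicator hB').aestronglyMeasurable,
        integral_map (by fun_prop) (hF.indicator hB').aestronglyMeasurable,
        integral_map (by fun_prop) (hF.indicator hB').aestronglyMeasurable]
      have hind : ∀ w, {w : ℝ × ℝ × E | (w.1, w.2.2) ∈ B}.indicator F w =
          B.indicator 1 (w.1, w.2.2) * F w := by
        classical
        intro w
        simp [indicator_apply]
      simp only [hind]
      rfl
    rw [hπ (fun w => w.2.1) (by fun_prop) (hqi.mono_measure hτle) hqv hqu,
      hπ (fun w => w.1) (by fun_prop) (hpi.mono_measure hτle) hpu hpv]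
    have hsplit : ∀ F : E × ℝ → ℝ, Measurable F → Integrable F l →
        ∫ z, b z * F z ∂l = ∫ z, b z * F z ∂τ +
          (∫ z, b (u z) * F (u z) ∂S + ∫ z, b (v z) * F (v z) ∂S) := by
      intro F hF hFi
      have hbF : Measurable fun z => b z * F z := hbm.mul hF
      conv_lhs => rw [← hτl]
      rw [integral_add_measure (hbi (hFi.mono_measure hτle))
        ((hbi (hFi.mono_measure hSu)).add_measure (hbi (hFi.mono_measure hSv))),
        integral_add_measure (hbi (hFi.mono_measure hSu)) (hbi (hFi.mono_measure hSv)),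
        integral_map hum.aemeasurable hbF.aestronglyMeasurable,
        integral_map hvm.aemeasurable hbF.aestronglyMeasurable]
    have hex : ∀ k : E × ℝ × ℝ → E × ℝ, Measurable k →
        ∫ z, b (k z) * (q (v z) - q (u z)) ∂S =
          ∫ z, b (k z) * q (v z) ∂S - ∫ z, b (k z) * q (u z) ∂S := by
      intro k hk
      have hbk : ∀ {F : E × ℝ × ℝ → ℝ}, Integrable F S → Integrable (fun z => b (k z) * F z) S :=
        fun hF => hF.bdd_mul (c := 1) (hbm.comp hk).aestronglyMeasurable
          (Eventually.of_forall fun z => hb1 _)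
      rw [← integral_sub (hbk hqv) (hbk hqu)]
      simp only [mul_sub]
    obtain ⟨h1, h2⟩ := hSb b hbm
    have hfi : Integrable (fun z => p z - q z) l := hpi.sub hqi
    have hgi : Integrable (fun z => q z - p z) l := hqi.sub hpi
    have h3 : ∫ z, b z * max (p z - q z) 0 ∂l - ∫ z, b z * max (q z - p z) 0 ∂l =
        ∫ z, b z * p z ∂l - ∫ z, b z * q z ∂l := by
      rw [← integral_sub (hbi hfi.pos_part) (hbi hgi.pos_part), ← integral_sub (hbi hpi) (hbi hqi)]
      refine integral_congr_ae (Eventually.of_forall fun z => ?_)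
      simp only
      rw [← mul_sub, ← mul_sub]
      congr 1
      rcases le_total (p z) (q z) with h | h
      · rw [max_eq_right (by linarith), max_eq_left (by linarith)]; ring
      · rw [max_eq_left (by linarith), max_eq_right (by linarith)]; ring
    have h4 := hsplit p hp hpi
    have h5 := hsplit q hq hqi
    have h6 := (hex u hum).symm.trans h1
    have h7 := (hex v hvm).symm.trans h2
    linarith

lemma integral_comp_quantile (μ : Measure ℝ) [IsProbabilityMeasure μ] {F : ℝ → ℝ}
    (hF : Measurable F) : ∫ t, F (quantile μ t) ∂uniformIoo = ∫ y, F y ∂μ := by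
  conv_rhs => rw [← map_quantile μ]
  rw [integral_map (measurable_quantile_right μ).aemeasurable hF.aestronglyMeasurable]

lemma integrable_quantile {μ : Measure ℝ} [IsProbabilityMeasure μ]
    (hμ : Integrable (fun y => y) μ) : Integrable (quantile μ) uniformIoo := by
  rw [← map_quantile μ] at hμ
  exact hμ.comp_measurable (measurable_quantile_right μ)

lemma integrable_max_sub {Ω : Type*} [MeasurableSpace Ω] {P : Measure Ω} [IsFiniteMeasure P]
    {f : Ω → ℝ} (hf : Integrable f P) (y : ℝ) : Integrable (fun ω => max (y - f ω) 0) P :=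
  ((integrable_const y).sub hf).pos_part

/-- The call-type inequalities extend from rational to real strikes. -/
lemma integral_max_sub_le_of_rat {μ ν : Measure ℝ} [IsProbabilityMeasure μ]
    [IsProbabilityMeasure ν] (hμ : Integrable (fun y => y) μ) (hν : Integrable (fun y => y) ν)
    (h : ∀ r : ℚ, ∫ t, max ((r : ℝ) - t) 0 ∂μ ≤ ∫ t, max ((r : ℝ) - t) 0 ∂ν) (y : ℝ) :
    ∫ t, max (y - t) 0 ∂μ ≤ ∫ t, max (y - t) 0 ∂ν := by
  refine le_of_forall_pos_le_add fun ε hε => ?_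
  obtain ⟨r, hr, hr'⟩ := exists_rat_btwn (lt_add_of_pos_right y hε)
  calc ∫ t, max (y - t) 0 ∂μ ≤ ∫ t, max ((r : ℝ) - t) 0 ∂μ :=
        integral_mono (integrable_max_sub hμ y) (integrable_max_sub hμ r)
          fun t => max_le_max (by linarith) le_rfl
    _ ≤ ∫ t, max ((r : ℝ) - t) 0 ∂ν := h r
    _ ≤ ∫ t, (max (y - t) 0 + ε) ∂ν :=
        integral_mono (integrable_max_sub hν r)
          ((integrable_max_sub hν y).add (integrable_const ε)) fun t =>
            max_le (by linarith [le_max_left (y - t) 0]) (by linarith [le_max_right (y - t) 0])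
    _ = ∫ t, max (y - t) 0 ∂ν + ε := by
        rw [integral_add (integrable_max_sub hν y) (integrable_const ε)]; simp

lemma setIntegral_quantile_le {μ ν : Measure ℝ} [IsProbabilityMeasure μ]
    [IsProbabilityMeasure ν] (hμ : Integrable (fun y => y) μ) (hν : Integrable (fun y => y) ν)
    (h : ∀ r : ℚ, ∫ t, max ((r : ℝ) - t) 0 ∂μ ≤ ∫ t, max ((r : ℝ) - t) 0 ∂ν)
    (hmean : ∫ y, y ∂μ = ∫ y, y ∂ν) (r : ℝ) :
    ∫ t in Iic r, quantile ν t ∂uniformIoo ≤ ∫ t in Iic r, quantile μ t ∂uniformIoo := by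
  have hpi := integrable_quantile hμ
  have hqi := integrable_quantile hν
  rcases le_or_gt r 0 with h0 | h0
  · have : uniformIoo.restrict (Iic r) = 0 := by
      rw [Measure.restrict_eq_zero, uniformIoo_Iic (by linarith), ENNReal.ofReal_eq_zero]
      exact h0
    simp [this]
  rcases le_or_gt 1 r with h1 | h1
  · have : uniformIoo.restrict (Iic r) = uniformIoo := by
      rw [Measure.restrict_eq_self_of_ae_mem]
      filter_upwards [ae_mem_Ioo_uniformIoo] with t ht
      exact ht.2.le.trans h1
    rw [this]
    exact (((integral_comp_quantile ν measurable_id).trans hmean.symm).trans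
      (integral_comp_quantile μ measurable_id).symm).le
  have hr : r ∈ Ioo (0 : ℝ) 1 := ⟨h0, h1⟩
  set y := quantile ν r with hy
  have hF : Measurable fun t : ℝ => max (y - t) 0 := by fun_prop
  have hq : ∫ t in Iic r, (y - quantile ν t) ∂uniformIoo = ∫ t, max (y - t) 0 ∂ν := by
    rw [← integral_comp_quantile ν hF, ← integral_indicator measurableSet_Iic]
    refine integral_congr_ae ?_
    filter_upwards [ae_mem_Ioo_uniformIoo] with t ht
    rcases le_or_gt t r with htr | htr
    · rw [indicator_of_mem (mem_Iic.2 htr), max_eq_left]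
      exact sub_nonneg.2 (monotoneOn_quantile ht hr htr)
    · rw [indicator_of_notMem (by simpa using htr), max_eq_right]
      exact sub_nonpos.2 (monotoneOn_quantile hr ht htr.le)
  have hp : ∫ t in Iic r, (y - quantile μ t) ∂uniformIoo ≤ ∫ t, max (y - t) 0 ∂μ := by
    rw [← integral_comp_quantile μ hF]
    refine (integral_mono ((integrable_const y).sub hpi).integrableOn
      (integrable_max_sub hpi y).integrableOn fun t => le_max_left _ _).trans ?_
    exact setIntegral_le_integral (integrable_max_sub hpi y)
      (Eventually.of_forall fun t => le_max_right _ _)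
  have hle := hp.trans ((integral_max_sub_le_of_rat hμ hν h y).trans hq.ge)
  rw [integral_sub (integrable_const y) hpi.integrableOn,
    integral_sub (integrable_const y) hqi.integrableOn] at hle
  linarith

/-- Conditional version of Strassen's theorem for martingale couplings on the real line. -/
lemma exists_martingale_coupling_compProd {E : Type*} [MeasurableSpace E] (μ : Measure E)
    [IsProbabilityMeasure μ] (κ η : Kernel E ℝ) [IsMarkovKernel κ] [IsMarkovKernel η]
    (hκ : Integrable (fun z : E × ℝ => z.2) (μ ⊗ₘ κ))
    (hη : Integrable (fun z : E × ℝ => z.2) (μ ⊗ₘ η))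
    (hcall : ∀ᵐ x ∂μ, ∀ r : ℚ, ∫ t, max ((r : ℝ) - t) 0 ∂κ x ≤ ∫ t, max ((r : ℝ) - t) 0 ∂η x)
    (hmean : ∀ᵐ x ∂μ, ∫ t, t ∂κ x = ∫ t, t ∂η x) :
    ∃ π : Measure (ℝ × ℝ × E),
      π.map (fun w => (w.1, w.2.2)) = (μ ⊗ₘ κ).map Prod.swap ∧
      π.map (fun w => (w.2.1, w.2.2)) = (μ ⊗ₘ η).map Prod.swap ∧
      ∀ B : Set (ℝ × E), MeasurableSet B →
        ∫ w in {w | (w.1, w.2.2) ∈ B}, w.2.1 ∂π = ∫ w in {w | (w.1, w.2.2) ∈ B}, w.1 ∂π := by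
  have hp := measurable_quantile κ
  have hq := measurable_quantile η
  have hpi : Integrable (fun z : E × ℝ => quantile (κ z.1) z.2) (μ.prod uniformIoo) := by
    rw [← map_prod_quantile] at hκ
    exact hκ.comp_measurable (measurable_fst.prodMk hp)
  have hqi : Integrable (fun z : E × ℝ => quantile (η z.1) z.2) (μ.prod uniformIoo) := by
    rw [← map_prod_quantile] at hη
    exact hη.comp_measurable (measurable_fst.prodMk hq)
  have hκx := ((Measure.integrable_compProd_iff hκ.1).1 hκ).1
  have hηx := ((Measure.integrable_compProd_iff hη.1).1 hη).1
  have hint : ∀ {F : E × ℝ → ℝ} {A : Set E} {R : Set ℝ}, Integrable F (μ.prod uniformIoo) →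
      IntegrableOn (fun x => ∫ t in R, F (x, t) ∂uniformIoo) A μ := by
    intro F A R hF
    have := hF.integrableOn (s := A ×ˢ R)
    rw [IntegrableOn, ← Measure.prod_restrict] at this
    exact this.integral_prod_left
  have hle : ∀ A : Set E, MeasurableSet A → ∀ r : ℚ,
      ∫ z in A ×ˢ Iic (r : ℝ), quantile (η z.1) z.2 ∂(μ.prod uniformIoo) ≤
        ∫ z in A ×ˢ Iic (r : ℝ), quantile (κ z.1) z.2 ∂(μ.prod uniformIoo) := by
    intro A hA r
    rw [setIntegral_prod _ hqi.integrableOn, setIntegral_prod _ hpi.integrableOn]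
    refine integral_mono_ae (hint hqi) (hint hpi) (ae_restrict_of_ae ?_)
    filter_upwards [hcall, hmean, hκx, hηx] with x g1 g2 g3 g4
    exact setIntegral_quantile_le g3 g4 g1 g2 r
  have heq : ∀ A : Set E, MeasurableSet A →
      ∫ z in A ×ˢ univ, quantile (η z.1) z.2 ∂(μ.prod uniformIoo) =
        ∫ z in A ×ˢ univ, quantile (κ z.1) z.2 ∂(μ.prod uniformIoo) := by
    intro A hA
    rw [setIntegral_prod _ hqi.integrableOn, setIntegral_prod _ hpi.integrableOn]
    refine integral_congr_ae (ae_restrict_of_ae ?_)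
    filter_upwards [hmean] with x g2
    rw [Measure.restrict_univ]
    exact ((integral_comp_quantile (η x) measurable_id).trans g2.symm).trans
      (integral_comp_quantile (κ x) measurable_id).symm
  have hT : ∀ᵐ z ∂(μ.prod uniformIoo), z.2 ∈ Ioo (0 : ℝ) 1 :=
    Measure.quasiMeasurePreserving_snd.ae ae_mem_Ioo_uniformIoo
  have hmono : ∀ x : E, MonotoneOn (fun t => quantile (κ x) t) (Ioo 0 1) :=
    fun x => monotoneOn_quantile
  obtain ⟨π, h1, h2, h3⟩ := exists_martingale_coupling_of_monotone (μ.prod uniformIoo)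
    (p := fun z => quantile (κ z.1) z.2) (q := fun z => quantile (η z.1) z.2)
    hp hq hpi hqi hT hmono hle heq
  refine ⟨π, h1.trans ?_, h2.trans ?_, h3⟩
  · rw [← map_prod_quantile, Measure.map_map measurable_swap (measurable_fst.prodMk hp)]
    rfl
  · rw [← map_prod_quantile, Measure.map_map measurable_swap (measurable_fst.prodMk hq)]
    rfl

lemma condExp_le_condExp_of_setIntegral_le {Ω : Type*} {m mΩ : MeasurableSpace Ω} {P : Measure Ω}
    [IsFiniteMeasure P] (hm : m ≤ mΩ) {f g : Ω → ℝ} (hf : Integrable f P) (hg : Integrable g P)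
    (h : ∀ s, MeasurableSet[m] s → ∫ ω in s, f ω ∂P ≤ ∫ ω in s, g ω ∂P) :
    P[f | m] ≤ᵐ[P] P[g | m] := by
  refine ae_le_of_ae_le_trim (hm := hm) ?_
  refine ae_le_of_forall_setIntegral_le (integrable_condExp.trim hm stronglyMeasurable_condExp)
    (integrable_condExp.trim hm stronglyMeasurable_condExp) fun s hs _ => ?_
  rw [← setIntegral_trim hm stronglyMeasurable_condExp hs,
    ← setIntegral_trim hm stronglyMeasurable_condExp hs, setIntegral_condExp hm hf hs,
    setIntegral_condExp hm hg hs]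
  exact h s hs

lemma setIntegral_comp_eq_of_map_eq {Ω Ω' E : Type*} [MeasurableSpace Ω] [MeasurableSpace Ω']
    [MeasurableSpace E] {P : Measure Ω} {P' : Measure Ω'} {Y : Ω → ℝ} {Y' : Ω' → ℝ}
    {X : Ω → E} {X' : Ω' → E} (hY : Measurable Y) (hX : Measurable X) (hY' : Measurable Y')
    (hX' : Measurable X')
    (h : P'.map (fun ω => (Y' ω, X' ω)) = P.map (fun ω => (Y ω, X ω))) {F : ℝ → ℝ}
    (hF : Measurable F) {A : Set E} (hA : MeasurableSet A) :
    ∫ ω in X ⁻¹' A, F (Y ω) ∂P = ∫ ω in X' ⁻¹' A, F (Y' ω) ∂P' := by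
  have hFm : Measurable fun z : ℝ × E => F z.1 := by fun_prop
  have h1 := setIntegral_map (μ := P) (measurable_snd hA) hFm.aestronglyMeasurable
    (hY.prodMk hX).aemeasurable
  have h2 := setIntegral_map (μ := P') (measurable_snd hA) hFm.aestronglyMeasurable
    (hY'.prodMk hX').aemeasurable
  rw [h] at h2
  exact h1.symm.trans h2

lemma integrable_of_map_prodMk_eq {Ω Ω' E : Type*} [MeasurableSpace Ω] [MeasurableSpace Ω']
    [MeasurableSpace E] {P : Measure Ω} {P' : Measure Ω'} {Y : Ω → ℝ} {Y' : Ω' → ℝ}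
    {X : Ω → E} {X' : Ω' → E} (hY : Measurable Y) (hX : Measurable X) (hY' : Measurable Y')
    (hX' : Measurable X')
    (h : P'.map (fun ω => (Y' ω, X' ω)) = P.map (fun ω => (Y ω, X ω))) (hi : Integrable Y P) :
    Integrable Y' P' := by
  have h1 : Integrable (fun z : ℝ × E => z.1) (P.map (fun ω => (Y ω, X ω))) :=
    (integrable_map_measure measurable_fst.aestronglyMeasurable (hY.prodMk hX).aemeasurable).2 hi
  rw [← h] at h1
  exact h1.comp_measurable (hY'.prodMk hX')

/-- The one-sided conditional Jensen inequality for the functions `(y - ·)⁺`, in integrated form. -/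
lemma setIntegral_max_sub_le_of_condExp_eq {Ω : Type*} {m mΩ : MeasurableSpace Ω} {P : Measure Ω}
    [IsFiniteMeasure P] (hm : m ≤ mΩ) {Y ψ : Ω → ℝ} (hY : Integrable Y P) (hψ : Integrable ψ P)
    (hψm : Measurable[m] ψ) (h : P[Y | m] =ᵐ[P] ψ) (y : ℝ) {s : Set Ω} (hs : MeasurableSet[m] s) :
    ∫ ω in s, max (y - ψ ω) 0 ∂P ≤ ∫ ω in s, max (y - Y ω) 0 ∂P := by
  have ht : MeasurableSet[m] {ω | ψ ω < y} := hψm measurableSet_Iio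
  have hst : MeasurableSet[m] (s ∩ {ω | ψ ω < y}) := hs.inter ht
  have hmart : ∫ ω in s ∩ {ω | ψ ω < y}, Y ω ∂P = ∫ ω in s ∩ {ω | ψ ω < y}, ψ ω ∂P := by
    rw [← setIntegral_condExp hm hY hst]
    exact integral_congr_ae (ae_restrict_of_ae h)
  calc ∫ ω in s, max (y - ψ ω) 0 ∂P = ∫ ω in s ∩ {ω | ψ ω < y}, (y - ψ ω) ∂P := by
        rw [← setIntegral_indicator (hm _ ht)]
        refine integral_congr_ae (Eventually.of_forall fun ω => ?_)
        by_cases hω : ψ ω < y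
        · simp [indicator, hω, hω.le]
        · simp [indicator, hω, not_lt.1 hω]
    _ = ∫ ω in s ∩ {ω | ψ ω < y}, (y - Y ω) ∂P := by
        rw [integral_sub (integrable_const y) hψ.integrableOn,
          integral_sub (integrable_const y) hY.integrableOn, hmart]
    _ ≤ ∫ ω in s ∩ {ω | ψ ω < y}, max (y - Y ω) 0 ∂P :=
        integral_mono ((integrable_const y).sub hY).integrableOn
          (integrable_max_sub hY y).integrableOn fun ω => le_max_left _ _
    _ ≤ ∫ ω in s, max (y - Y ω) 0 ∂P :=
        setIntegral_mono_set (integrable_max_sub hY y).integrableOn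
          (Eventually.of_forall fun ω => le_max_right _ _) (inter_subset_left.eventuallyLE)

lemma measurable_integral_kernel {E : Type*} [MeasurableSpace E] (κ : Kernel E ℝ) [IsMarkovKernel κ]
    {F : ℝ → ℝ} (hF : Measurable F) : Measurable fun x => ∫ t, F t ∂κ x :=
  (hF.stronglyMeasurable.integral_kernel (κ := κ)).measurable

lemma H0_of_H0XOn {Ω Ω' : Type} [MeasurableSpace Ω] [mΩ' : MeasurableSpace Ω'] {P : Measure Ω}
    {P' : Measure Ω'} {d : ℕ} {Y ψ : Ω → ℝ} {X : Ω → Fin d → ℝ} (hYm : Measurable Y)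
    (hψm : Measurable ψ) (hXm : Measurable X)
    (h : H0XOn Ω' P' d (P.map (fun ω => (Y ω, X ω))) (P.map (fun ω => (ψ ω, X ω)))) :
    H0 (P.map Y) (P.map ψ) := by
  obtain ⟨hP', Y', ψ', X', hY', hψ', hX', h1, h2, h3⟩ := h
  refine ⟨Ω', mΩ', P', hP', Y', ψ', hY', hψ', ?_, ?_, _, (hψ'.prodMk hX').comap_le, ?_, h3⟩
  · have := congrArg (Measure.map Prod.fst) h1
    rwa [Measure.map_map measurable_fst (hY'.prodMk hX'),
      Measure.map_map measurable_fst (hYm.prodMk hXm)] at this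
  · have := congrArg (Measure.map Prod.fst) h2
    rwa [Measure.map_map measurable_fst (hψ'.prodMk hX'),
      Measure.map_map measurable_fst (hψm.prodMk hXm)] at this
  · exact Measurable.comap_le (measurable_fst.comp (comap_measurable fun ω => (ψ' ω, X' ω)))

lemma conditional_moment_conditions_of_H0XOn {Ω Ω' : Type} [MeasurableSpace Ω]
    [MeasurableSpace Ω'] {P : Measure Ω} [IsProbabilityMeasure P] {P' : Measure Ω'} {d : ℕ}
    {Y ψ : Ω → ℝ} {X : Ω → Fin d → ℝ} (hYm : Measurable Y) (hψm : Measurable ψ)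
    (hXm : Measurable X) (hYi : Integrable Y P) (hψi : Integrable ψ P)
    (h : H0XOn Ω' P' d (P.map (fun ω => (Y ω, X ω))) (P.map (fun ω => (ψ ω, X ω)))) :
    (∀ y : ℝ, P[fun ω => max (y - ψ ω) 0 | MeasurableSpace.comap X inferInstance]
        ≤ᵐ[P] P[fun ω => max (y - Y ω) 0 | MeasurableSpace.comap X inferInstance]) ∧
      P[Y | MeasurableSpace.comap X inferInstance]
        =ᵐ[P] P[ψ | MeasurableSpace.comap X inferInstance] := by
  obtain ⟨hP', Y', ψ', X', hY', hψ', hX', h1, h2, h3⟩ := h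
  have hYi' := integrable_of_map_prodMk_eq hYm hXm hY' hX' h1 hYi
  have hψi' := integrable_of_map_prodMk_eq hψm hXm hψ' hX' h2 hψi
  have hm := (hψ'.prodMk hX').comap_le
  have hpair : Measurable[MeasurableSpace.comap (fun ω => (ψ' ω, X' ω)) inferInstance]
      fun ω => (ψ' ω, X' ω) := comap_measurable _
  have hψσ : Measurable[MeasurableSpace.comap (fun ω => (ψ' ω, X' ω)) inferInstance] ψ' :=
    measurable_fst.comp hpair
  have hXσ : Measurable[MeasurableSpace.comap (fun ω => (ψ' ω, X' ω)) inferInstance] X' :=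
    measurable_snd.comp hpair
  have hmean : ∀ A : Set (Fin d → ℝ), MeasurableSet A →
      ∫ ω in X ⁻¹' A, Y ω ∂P = ∫ ω in X ⁻¹' A, ψ ω ∂P := by
    intro A hA
    rw [setIntegral_comp_eq_of_map_eq hYm hXm hY' hX' h1 (F := fun y => y) measurable_id hA,
      setIntegral_comp_eq_of_map_eq hψm hXm hψ' hX' h2 (F := fun y => y) measurable_id hA]
    rw [← setIntegral_condExp hm hYi' (hXσ hA)]
    exact integral_congr_ae (ae_restrict_of_ae h3)
  constructor
  · intro y
    refine condExp_le_condExp_of_setIntegral_le hXm.comap_le (integrable_max_sub hψi y)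
      (integrable_max_sub hYi y) ?_
    rintro _ ⟨A, hA, rfl⟩
    have hF : Measurable fun t : ℝ => max (y - t) 0 := by fun_prop
    rw [setIntegral_comp_eq_of_map_eq hYm hXm hY' hX' h1 hF hA,
      setIntegral_comp_eq_of_map_eq hψm hXm hψ' hX' h2 hF hA]
    exact setIntegral_max_sub_le_of_condExp_eq hm hYi' hψi' hψσ h3 y (hXσ hA)
  · refine (condExp_le_condExp_of_setIntegral_le hXm.comap_le hYi hψi ?_).antisymm
      (condExp_le_condExp_of_setIntegral_le hXm.comap_le hψi hYi ?_)
    · rintro _ ⟨A, hA, rfl⟩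
      exact (hmean A hA).le
    · rintro _ ⟨A, hA, rfl⟩
      exact (hmean A hA).ge

lemma exists_H0XOn_of_conditional_moment_conditions {Ω : Type} [MeasurableSpace Ω]
    {P : Measure Ω} [IsProbabilityMeasure P] {d : ℕ} {Y ψ : Ω → ℝ} {X : Ω → Fin d → ℝ}
    (hYm : Measurable Y) (hψm : Measurable ψ) (hXm : Measurable X) (hYi : Integrable Y P)
    (hψi : Integrable ψ P)
    (hcall : ∀ y : ℝ, P[fun ω => max (y - ψ ω) 0 | MeasurableSpace.comap X inferInstance]
        ≤ᵐ[P] P[fun ω => max (y - Y ω) 0 | MeasurableSpace.comap X inferInstance])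
    (hmean : P[Y | MeasurableSpace.comap X inferInstance]
        =ᵐ[P] P[ψ | MeasurableSpace.comap X inferInstance]) :
    ∃ (Ω' : Type) (mΩ' : MeasurableSpace Ω') (P' : @Measure Ω' mΩ'),
      @H0XOn Ω' mΩ' P' d (P.map (fun ω => (Y ω, X ω))) (P.map (fun ω => (ψ ω, X ω))) := by
  have hμ : IsProbabilityMeasure (P.map X) := Measure.isProbabilityMeasure_map hXm.aemeasurable
  have hκ : P.map X ⊗ₘ condDistrib ψ X P = P.map fun ω => (X ω, ψ ω) :=
    compProd_map_condDistrib hψm.aemeasurable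
  have hη : P.map X ⊗ₘ condDistrib Y X P = P.map fun ω => (X ω, Y ω) :=
    compProd_map_condDistrib hYm.aemeasurable
  have hFm : ∀ r : ℝ, Measurable fun t : ℝ => max (r - t) 0 := fun r => by fun_prop
  obtain ⟨π, h1, h2, h3⟩ := exists_martingale_coupling_compProd (P.map X) (condDistrib ψ X P)
    (condDistrib Y X P)
    (by
      rw [hκ]
      exact (integrable_map_measure measurable_snd.aestronglyMeasurable
        (hXm.prodMk hψm).aemeasurable).2 hψi)
    (by
      rw [hη]
      exact (integrable_map_measure measurable_snd.aestronglyMeasurable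
        (hXm.prodMk hYm).aemeasurable).2 hYi)
    (by
      rw [ae_all_iff]
      intro r
      rw [ae_map_iff hXm.aemeasurable (measurableSet_le (measurable_integral_kernel _ (hFm r))
        (measurable_integral_kernel _ (hFm r)))]
      filter_upwards [hcall r,
        condExp_ae_eq_integral_condDistrib hXm hψm.aemeasurable (hFm r).stronglyMeasurable
          (integrable_max_sub hψi r),
        condExp_ae_eq_integral_condDistrib hXm hYm.aemeasurable (hFm r).stronglyMeasurable
          (integrable_max_sub hYi r)] with ω g1 g2 g3
      rwa [g2, g3] at g1)
    (by
      rw [ae_map_iff hXm.aemeasurable (measurableSet_eq_fun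
        (measurable_integral_kernel _ (F := fun t => t) measurable_id)
        (measurable_integral_kernel _ (F := fun t => t) measurable_id))]
      filter_upwards [hmean, condExp_ae_eq_integral_condDistrib' hXm hψi,
        condExp_ae_eq_integral_condDistrib' hXm hYi] with ω g1 g2 g3
      rw [g2, g3] at g1
      exact g1.symm)
  rw [hκ, Measure.map_map measurable_swap (hXm.prodMk hψm)] at h1
  rw [hη, Measure.map_map measurable_swap (hXm.prodMk hYm)] at h2
  have hψ' : Measurable fun w : ℝ × ℝ × (Fin d → ℝ) => w.1 := by fun_prop
  have hY' : Measurable fun w : ℝ × ℝ × (Fin d → ℝ) => w.2.1 := by fun_prop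
  have hX' : Measurable fun w : ℝ × ℝ × (Fin d → ℝ) => w.2.2 := by fun_prop
  have hπ : IsProbabilityMeasure π := by
    have : IsProbabilityMeasure (π.map fun w => (w.1, w.2.2)) := by
      rw [h1]
      exact Measure.isProbabilityMeasure_map (by fun_prop)
    exact Measure.isProbabilityMeasure_of_map (fun w => (w.1, w.2.2))
  have hYi' := integrable_of_map_prodMk_eq hYm hXm hY' hX' h2 hYi
  have hψi' := integrable_of_map_prodMk_eq hψm hXm hψ' hX' h1 hψi
  refine ⟨_, _, π, hπ, _, _, _, hY', hψ', hX', h2, h1, ?_⟩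
  refine (ae_eq_condExp_of_forall_setIntegral_eq (hψ'.prodMk hX').comap_le hYi'
    (fun s _ _ => hψi'.integrableOn) ?_ ?_).symm
  · rintro _ ⟨B, hB, rfl⟩ -
    exact (h3 B hB).symm
  · exact (measurable_fst.comp (comap_measurable
      fun w : ℝ × ℝ × (Fin d → ℝ) => (w.1, w.2.2))).aestronglyMeasurable

/-- Proposition 2 of the paper: H₀X (rationalizing rational expectations given covariates `X`)
is equivalent to the conditional moment inequalities
`E[(y - Y)⁺ | X] ≥ E[(y - ψ)⁺ | X]` a.s. for all `y` together with the conditional moment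
equality `E[Y | X] = E[ψ | X]` a.s.; moreover H₀X implies H₀. -/
theorem H0X_iff_conditional_moment_conditions
    {Ω : Type} [MeasurableSpace Ω] (P : Measure Ω) [IsProbabilityMeasure P]
    {d : ℕ} {Y ψ : Ω → ℝ} {X : Ω → Fin d → ℝ}
    (hYm : Measurable Y) (hψm : Measurable ψ) (hXm : Measurable X)
    (hYi : Integrable Y P) (hψi : Integrable ψ P) :
    ((∃ (Ω' : Type) (mΩ' : MeasurableSpace Ω') (P' : @Measure Ω' mΩ'),
        @H0XOn Ω' mΩ' P' d (P.map (fun ω => (Y ω, X ω))) (P.map (fun ω => (ψ ω, X ω)))) ↔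
      ((∀ y : ℝ,
          P[fun ω => max (y - ψ ω) 0 | MeasurableSpace.comap X inferInstance]
            ≤ᵐ[P] P[fun ω => max (y - Y ω) 0 | MeasurableSpace.comap X inferInstance]) ∧
        P[Y | MeasurableSpace.comap X inferInstance]
          =ᵐ[P] P[ψ | MeasurableSpace.comap X inferInstance])) ∧
    ((∃ (Ω' : Type) (mΩ' : MeasurableSpace Ω') (P' : @Measure Ω' mΩ'),
        @H0XOn Ω' mΩ' P' d (P.map (fun ω => (Y ω, X ω))) (P.map (fun ω => (ψ ω, X ω)))) →
      H0 (P.map Y) (P.map ψ)) := by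
  refine ⟨⟨?_, ?_⟩, ?_⟩
  · rintro ⟨Ω', mΩ', P', h⟩
    exact conditional_moment_conditions_of_H0XOn hYm hψm hXm hYi hψi h
  · rintro ⟨h1, h2⟩
    exact exists_H0XOn_of_conditional_moment_conditions hYm hψm hXm hYi hψi h1 h2
  · rintro ⟨Ω', mΩ', P', h⟩
    exact H0_of_H0XOn hYm hψm hXm h
end

section
/- Let Y and ψ be real random variables and q : ℝ × ℝ → ℝ a measurable function such that E|ψ| < ∞, E|q(Y, c)| < ∞ for all c ∈ ℝ, and the equation E[q(Y, c)] = E[ψ] admits a unique solution c₀ ∈ ℝ. Then the following are equivalent: (i) H₀S holds, i.e., there exist, on some probability space, random variables (Y', ψ'), a sub-σ-algebra I' and c ∈ ℝ such that σ(ψ') ⊆ I', Y' is distributed as Y, ψ' is distributed as ψ, and E[q(Y', c) | I'] = ψ' almost surely; (ii) E[(y − q(Y, c₀))⁺ − (y − ψ)⁺] ≥ 0 for all y ∈ ℝ. -/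
open MeasureTheory ProbabilityTheory

/-- H₀S realized on a given probability space `(Ω, P)`: there are random variables `Y'`, `ψ'`,
a sub-σ-algebra `I'` and `c ∈ ℝ` such that `σ(ψ') ⊆ I'`, `Y' ∼ μY`, `ψ' ∼ μψ` and
`E[q(Y', c) | I'] = ψ'` almost surely. -/
def H0SOn (Ω : Type) [mΩ : MeasurableSpace Ω] (P : Measure Ω) (q : ℝ → ℝ → ℝ)
    (μY μψ : Measure ℝ) : Prop :=
  IsProbabilityMeasure P ∧
    ∃ Y' ψ' : Ω → ℝ,
      Measurable Y' ∧ Measurable ψ' ∧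
      P.map Y' = μY ∧ P.map ψ' = μψ ∧
      ∃ (I' : MeasurableSpace Ω) (c : ℝ),
        I' ≤ mΩ ∧
        MeasurableSpace.comap ψ' Real.measurableSpace ≤ I' ∧
        P[fun ω => q (Y' ω) c | I'] =ᵐ[P] ψ'

/-- A generalized inverse of the cdf of `μ` on `(0, 1)`. -/
theorem exists_quantile (μ : Measure ℝ) :
    ∃ g : ℝ → ℝ, Measurable g ∧ ∀ p ∈ Set.Ioo (0 : ℝ) 1, ∀ x, g p ≤ x ↔ p ≤ cdf μ x := by
  classical
  let g : ℝ → ℝ := fun p => if p ∈ Set.Ioo (0 : ℝ) 1 then sInf {x | p ≤ cdf μ x} else 0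
  have hg : ∀ p ∈ Set.Ioo (0 : ℝ) 1, ∀ x, g p ≤ x ↔ p ≤ cdf μ x := by
    intro p hp x
    have hgp : g p = sInf {x | p ≤ cdf μ x} := if_pos hp
    obtain ⟨b, hb⟩ := ((tendsto_cdf_atTop μ).eventually (lt_mem_nhds hp.2)).exists
    obtain ⟨a, ha⟩ := ((tendsto_cdf_atBot μ).eventually (gt_mem_nhds hp.1)).exists
    have hbdd : BddBelow {x | p ≤ cdf μ x} := by
      refine ⟨a, fun z hz => ?_⟩
      by_contra! h
      exact absurd (hz.trans (monotone_cdf μ h.le)) (not_le.2 ha)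
    have hne : {x | p ≤ cdf μ x}.Nonempty := ⟨b, hb.le⟩
    rw [hgp]
    refine ⟨fun h => ?_, fun h => csInf_le hbdd h⟩
    have hright : Filter.Tendsto (cdf μ) (nhdsWithin x (Set.Ioi x)) (nhds (cdf μ x)) :=
      ((cdf μ).right_continuous x).mono_left (nhdsWithin_mono _ Set.Ioi_subset_Ici_self)
    refine ge_of_tendsto hright ?_
    filter_upwards [self_mem_nhdsWithin] with z hz
    obtain ⟨w, hw, hwz⟩ := exists_lt_of_csInf_lt hne (lt_of_le_of_lt h hz)
    exact le_trans hw (monotone_cdf μ hwz.le)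
  refine ⟨g, measurable_of_Iic fun x => ?_, hg⟩
  have : g ⁻¹' Set.Iic x = (Set.Ioo 0 1 ∩ Set.Iic (cdf μ x)) ∪ ((Set.Ioo 0 1)ᶜ ∩ {_p | 0 ≤ x}) := by
    ext p
    by_cases hp : p ∈ Set.Ioo (0 : ℝ) 1
    · have := hg p hp x
      simp only [Set.mem_preimage, Set.mem_Iic, Set.mem_union, Set.mem_inter_iff, hp, true_and,
        Set.mem_compl_iff, not_true, false_and, or_false, this]
    · have h0 : g p = 0 := if_neg hp
      simp only [Set.mem_preimage, Set.mem_Iic, Set.mem_union, Set.mem_inter_iff, hp, false_and,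
        Set.mem_compl_iff, not_false_eq_true, true_and, false_or, h0, Set.mem_ofPred_eq]
  rw [this]
  exact (measurableSet_Ioo.inter measurableSet_Iic).union
    (measurableSet_Ioo.compl.inter (MeasurableSet.const _))

theorem map_quantile_s6 {μ : Measure ℝ} [IsProbabilityMeasure μ] {g : ℝ → ℝ} (hgm : Measurable g)
    (hg : ∀ p ∈ Set.Ioo (0 : ℝ) 1, ∀ x, g p ≤ x ↔ p ≤ cdf μ x) :
    (volume.restrict (Set.Ioo (0 : ℝ) 1)).map g = μ := by
  refine Measure.ext_of_Iic _ _ fun x => ?_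
  rw [Measure.map_apply hgm measurableSet_Iic, Measure.restrict_apply (hgm measurableSet_Iic),
    ← ofReal_cdf μ x]
  have : g ⁻¹' Set.Iic x ∩ Set.Ioo 0 1 = Set.Iic (cdf μ x) ∩ Set.Ioo 0 1 := by
    ext p
    simp only [Set.mem_inter_iff, Set.mem_preimage, Set.mem_Iic, and_congr_left_iff]
    exact fun hp => hg p hp x
  rw [this]
  refine le_antisymm ?_ ?_
  · calc volume (Set.Iic (cdf μ x) ∩ Set.Ioo 0 1) ≤ volume (Set.Ioc 0 (cdf μ x)) :=
          measure_mono (fun p hp => ⟨hp.2.1, hp.1⟩)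
      _ = _ := by simp
  · calc ENNReal.ofReal (cdf μ x) = volume (Set.Ioo 0 (cdf μ x)) := by simp
      _ ≤ volume (Set.Iic (cdf μ x) ∩ Set.Ioo 0 1) :=
          measure_mono fun p hp => ⟨hp.2.le, hp.1, hp.2.trans_le (cdf_le_one μ x)⟩

/-- Stochastic dominance of finite measures on `ℝ` is realized by a monotone coupling. -/
theorem exists_monotone_coupling_s6 (m₁ m₂ : Measure ℝ) [IsFiniteMeasure m₁] [IsFiniteMeasure m₂]
    (huniv : m₁ Set.univ = m₂ Set.univ) (hdom : ∀ t, m₂ (Set.Iic t) ≤ m₁ (Set.Iic t)) :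
    ∃ α : Measure (ℝ × ℝ), α.map Prod.fst = m₁ ∧ α.map Prod.snd = m₂ ∧
      ∀ᵐ p ∂α, p.1 ≤ p.2 := by
  by_cases h0 : m₁ Set.univ = 0
  · refine ⟨0, ?_, ?_, by simp⟩
    · simpa using (Measure.measure_univ_eq_zero.1 h0).symm
    · simpa using (Measure.measure_univ_eq_zero.1 (huniv ▸ h0)).symm
  set M := m₁ Set.univ with hM
  have hMtop : M ≠ ⊤ := measure_ne_top _ _
  have hP₁ : IsProbabilityMeasure (M⁻¹ • m₁) := ⟨by
    simp [← hM, ENNReal.inv_mul_cancel h0 hMtop]⟩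
  have hP₂ : IsProbabilityMeasure (M⁻¹ • m₂) := ⟨by
    simp [← huniv, ENNReal.inv_mul_cancel h0 hMtop]⟩
  obtain ⟨g₁, hg₁m, hg₁⟩ := exists_quantile (M⁻¹ • m₁)
  obtain ⟨g₂, hg₂m, hg₂⟩ := exists_quantile (M⁻¹ • m₂)
  refine ⟨M • (volume.restrict (Set.Ioo (0 : ℝ) 1)).map (fun p => (g₁ p, g₂ p)), ?_, ?_, ?_⟩
  · rw [Measure.map_smul, Measure.map_map measurable_fst (by fun_prop)]
    change M • Measure.map g₁ _ = _
    rw [map_quantile_s6 hg₁m hg₁, smul_smul, ENNReal.mul_inv_cancel h0 hMtop, one_smul]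
  · rw [Measure.map_smul, Measure.map_map measurable_snd (by fun_prop)]
    change M • Measure.map g₂ _ = _
    rw [map_quantile_s6 hg₂m hg₂, smul_smul, ENNReal.mul_inv_cancel h0 hMtop, one_smul]
  · refine Measure.ae_smul_measure ?_ M
    rw [ae_map_iff (by fun_prop) (measurableSet_le measurable_fst measurable_snd),
      ae_restrict_iff' measurableSet_Ioo]
    refine ae_of_all _ fun p hp => ?_
    rw [hg₁ p hp]
    refine ((hg₂ p hp _).1 le_rfl).trans ?_
    rw [cdf_eq_real, cdf_eq_real]
    refine ENNReal.toReal_mono (measure_ne_top _ _) ?_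
    simp only [Measure.smul_apply, smul_eq_mul]
    exact mul_le_mul_right (hdom _) _

/-- Moving mass symmetrically between the points where `y < x` and those where `x < y` produces
a coupling of `l` with itself under which `y` of the second coordinate has conditional mean `x`
of the first. -/
theorem exists_symmetric_transport {E : Type*} [MeasurableSpace E] (l : Measure E)
    [IsFiniteMeasure l] {x y : E → ℝ} (hxm : Measurable x) (hym : Measurable y)
    (hxi : Integrable x l) (hyi : Integrable y l) (α : Measure (E × E))
    (hα₁ : α.map Prod.fst = l.withDensity fun u => ENNReal.ofReal (x u - y u))
    (hα₂ : α.map Prod.snd = l.withDensity fun u => ENNReal.ofReal (y u - x u))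
    (hα : ∀ᵐ p ∂α, x p.1 ≤ x p.2) :
    ∃ π : Measure (E × E), π.map Prod.fst = l ∧ π.map Prod.snd = l ∧
      ∀ A, MeasurableSet A → ∫ p in Prod.fst ⁻¹' A, y p.2 ∂π = ∫ u in A, x u ∂l := by
  have hpos : ∀ᵐ p ∂α, y p.1 < x p.1 := by
    refine ae_of_ae_map (p := fun u => y u < x u) measurable_fst.aemeasurable ?_
    rw [hα₁, ae_withDensity_iff (by fun_prop)]
    refine ae_of_all _ fun u hu => ?_
    simpa using hu
  have hneg : ∀ᵐ p ∂α, x p.2 < y p.2 := by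
    refine ae_of_ae_map (p := fun u => x u < y u) measurable_snd.aemeasurable ?_
    rw [hα₂, ae_withDensity_iff (by fun_prop)]
    refine ae_of_all _ fun u hu => ?_
    simpa using hu
  let g : E × E → ENNReal := fun p => (ENNReal.ofReal (y p.2 - y p.1))⁻¹
  have hgm : Measurable g := by fun_prop
  let α' := α.withDensity g
  have hdens : ∀ f : E → ENNReal, Measurable f → ∀ A, MeasurableSet A →
      ∫⁻ u in A, (f u)⁻¹ ∂(l.withDensity f) ≤ l.restrict {u | f u ≠ 0} A := by
    intro f hf A hA
    have hS : MeasurableSet {u | f u ≠ 0} := hf (measurableSet_singleton 0).compl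
    rw [restrict_withDensity hA, lintegral_withDensity_eq_lintegral_mul _ hf (by fun_prop),
      Measure.restrict_apply hA, Set.inter_comm, ← Measure.restrict_apply hS,
      ← lintegral_indicator_one hS]
    refine lintegral_mono fun u => ?_
    by_cases hu : f u = 0
    · simp [hu]
    · rw [Set.indicator_of_mem (by exact hu)]
      exact ENNReal.mul_inv_le_one _
  have hβ₁ : α'.map Prod.fst ≤ l.restrict {u | ENNReal.ofReal (x u - y u) ≠ 0} := by
    refine Measure.le_iff.2 fun A hA => ?_
    refine le_trans ?_ (hdens (fun u => ENNReal.ofReal (x u - y u)) (by fun_prop) A hA)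
    rw [← hα₁, setLIntegral_map hA (by fun_prop) measurable_fst,
      Measure.map_apply measurable_fst hA, withDensity_apply _ (measurable_fst hA)]
    refine lintegral_mono_ae (ae_restrict_of_ae ?_)
    filter_upwards [hpos, hneg, hα] with p h1 h2 h3
    simp only [g]
    gcongr
    linarith
  have hβ₂ : α'.map Prod.snd ≤ l.restrict {u | ENNReal.ofReal (y u - x u) ≠ 0} := by
    refine Measure.le_iff.2 fun A hA => ?_
    refine le_trans ?_ (hdens (fun u => ENNReal.ofReal (y u - x u)) (by fun_prop) A hA)
    rw [← hα₂, setLIntegral_map hA (by fun_prop) measurable_snd,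
      Measure.map_apply measurable_snd hA, withDensity_apply _ (measurable_snd hA)]
    refine lintegral_mono_ae (ae_restrict_of_ae ?_)
    filter_upwards [hpos, hneg, hα] with p h1 h2 h3
    simp only [g]
    gcongr
    linarith
  let β := α'.map Prod.fst + α'.map Prod.snd
  have hβ : β ≤ l := by
    have hdisj : Disjoint {u | ENNReal.ofReal (x u - y u) ≠ 0}
        {u | ENNReal.ofReal (y u - x u) ≠ 0} := by
      rw [Set.disjoint_left]
      intro u h1 h2
      simp only [ne_eq, ENNReal.ofReal_eq_zero, not_le, Set.mem_ofPred_eq] at h1 h2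
      linarith
    have hm : MeasurableSet {u | ENNReal.ofReal (y u - x u) ≠ 0} :=
      (show Measurable fun u => ENNReal.ofReal (y u - x u) by fun_prop)
        (measurableSet_singleton 0).compl
    calc β ≤ _ := add_le_add hβ₁ hβ₂
      _ = l.restrict _ := (Measure.restrict_union hdisj hm).symm
      _ ≤ l := Measure.restrict_le_self
  have : IsFiniteMeasure β := isFiniteMeasure_of_le l hβ
  have hsub : l - β + β = l := Measure.sub_add_cancel_of_le hβ
  let π := α' + α'.map Prod.swap + (l - β).map fun u => (u, u)
  have hdiag : Measurable fun u : E => (u, u) := by fun_prop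
  have hπ₁ : π.map Prod.fst = l := by
    simp only [π]
    rw [Measure.map_add _ _ measurable_fst, Measure.map_add _ _ measurable_fst,
      Measure.map_map measurable_fst measurable_swap, Measure.map_map measurable_fst hdiag]
    change β + (l - β).map id = l
    rw [Measure.map_id, add_comm, hsub]
  have hπ₂ : π.map Prod.snd = l := by
    simp only [π]
    rw [Measure.map_add _ _ measurable_snd, Measure.map_add _ _ measurable_snd,
      Measure.map_map measurable_snd measurable_swap, Measure.map_map measurable_snd hdiag]
    change α'.map Prod.snd + α'.map Prod.fst + (l - β).map id = l
    rw [Measure.map_id, add_comm (α'.map Prod.snd), add_comm]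
    exact hsub
  refine ⟨π, hπ₁, hπ₂, fun A hA => ?_⟩
  obtain ⟨h, hh⟩ : ∃ h : E → ℝ, h = A.indicator fun _ => 1 := ⟨_, rfl⟩
  have hhm : Measurable h := hh ▸ measurable_const.indicator hA
  have hhb : ∀ u, ‖h u‖ ≤ 1 := fun u => by
    by_cases hu : u ∈ A <;> simp [hh, hu]
  have hy₁ : Integrable (fun p : E × E => y p.1) π :=
    Integrable.comp_measurable (g := y) (by rwa [hπ₁]) measurable_fst
  have hy₂ : Integrable (fun p : E × E => y p.2) π :=
    Integrable.comp_measurable (g := y) (by rwa [hπ₂]) measurable_snd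
  have hF : Integrable (fun p : E × E => h p.1 * (y p.2 - y p.1)) π :=
    (hy₂.sub hy₁).bdd_mul (c := 1) (hhm.comp measurable_fst).aestronglyMeasurable
      (ae_of_all _ fun p => hhb _)
  have hF₁ : Integrable (fun p : E × E => h p.1 * (y p.2 - y p.1)) α' :=
    hF.mono_measure (Measure.le_add_right (Measure.le_add_right le_rfl))
  have hF₂ : Integrable (fun p : E × E => h p.1 * (y p.2 - y p.1)) (α'.map Prod.swap) :=
    hF.mono_measure (Measure.le_add_right (Measure.le_add_left le_rfl))
  have hF₃ : Integrable (fun p : E × E => h p.1 * (y p.2 - y p.1))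
      ((l - β).map fun u => (u, u)) :=
    hF.mono_measure (Measure.le_add_left le_rfl)
  have hgfin : ∀ᵐ p ∂α, g p < ⊤ := by
    filter_upwards [hpos, hneg, hα] with p h1 h2 h3
    simp only [g, ENNReal.inv_lt_top, ENNReal.ofReal_pos]
    linarith
  have hgmul : ∀ᵐ p ∂α, (g p).toReal * (y p.2 - y p.1) = 1 := by
    filter_upwards [hpos, hneg, hα] with p h1 h2 h3
    have : 0 < y p.2 - y p.1 := by linarith
    simp only [g, ENNReal.toReal_inv, ENNReal.toReal_ofReal this.le]
    exact inv_mul_cancel₀ this.ne'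
  have hd : Integrable (fun u => x u - y u) l := hxi.sub hyi
  have hd' : Integrable (fun u => y u - x u) l := hyi.sub hxi
  have e₁ : ∫ p, h p.1 * (y p.2 - y p.1) ∂α' = ∫ u, h u * max (x u - y u) 0 ∂l := by
    rw [integral_withDensity_eq_integral_toReal_smul hgm hgfin]
    calc _ = ∫ p, h p.1 ∂α := by
          refine integral_congr_ae ?_
          filter_upwards [hgmul] with p hp
          rw [smul_eq_mul, mul_left_comm, hp, mul_one]
      _ = ∫ u, h u ∂(α.map Prod.fst) :=
          (integral_map measurable_fst.aemeasurable hhm.aestronglyMeasurable).symm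
      _ = _ := by
          rw [hα₁, integral_withDensity_eq_integral_toReal_smul (by fun_prop) (by simp)]
          simp only [ENNReal.toReal_ofReal', smul_eq_mul, mul_comm]
  have e₂ : ∫ p, h p.1 * (y p.2 - y p.1) ∂(α'.map Prod.swap)
      = - ∫ u, h u * max (y u - x u) 0 ∂l := by
    rw [integral_map measurable_swap.aemeasurable hF₂.1,
      integral_withDensity_eq_integral_toReal_smul hgm hgfin, ← integral_neg]
    calc _ = ∫ p, - h p.2 ∂α := by
          refine integral_congr_ae ?_
          filter_upwards [hgmul] with p hp
          simp only [smul_eq_mul, Prod.fst_swap, Prod.snd_swap]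
          linear_combination (- h p.2) * hp
      _ = ∫ u, - h u ∂(α.map Prod.snd) :=
          (integral_map measurable_snd.aemeasurable hhm.neg.aestronglyMeasurable).symm
      _ = _ := by
          rw [hα₂, integral_withDensity_eq_integral_toReal_smul (by fun_prop) (by simp)]
          simp only [ENNReal.toReal_ofReal', smul_eq_mul, mul_neg, mul_comm (h _)]
  have e₃ : ∫ p, h p.1 * (y p.2 - y p.1) ∂((l - β).map fun u => (u, u)) = 0 := by
    rw [integral_map hdiag.aemeasurable hF₃.1]
    simp
  have hhi : ∀ {f : E → ℝ}, Integrable f l → Integrable (fun u => h u * f u) l := fun hf =>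
    hf.bdd_mul (c := 1) (by fun_prop) (ae_of_all _ fun p => hhb _)
  have e₄ : ∫ p, h p.1 * y p.1 ∂π = ∫ u, h u * y u ∂l := by
    conv_rhs => rw [← hπ₁]
    rw [integral_map measurable_fst.aemeasurable (by fun_prop)]
  have hyh : Integrable (fun p : E × E => h p.1 * y p.1) π :=
    hy₁.bdd_mul (c := 1) (hhm.comp measurable_fst).aestronglyMeasurable
      (ae_of_all _ fun p => hhb _)
  calc ∫ p in Prod.fst ⁻¹' A, y p.2 ∂π = ∫ p, h p.1 * y p.2 ∂π := by
        rw [← integral_indicator (measurable_fst hA)]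
        refine integral_congr_ae (ae_of_all _ fun p => ?_)
        by_cases hp : p.1 ∈ A <;> simp [hh, hp]
    _ = ∫ p, h p.1 * (y p.2 - y p.1) ∂π + ∫ p, h p.1 * y p.1 ∂π := by
        rw [← integral_add hF hyh]
        congr 1
        ext p
        ring
    _ = ∫ u, h u * max (x u - y u) 0 ∂l + - ∫ u, h u * max (y u - x u) 0 ∂l + 0
          + ∫ u, h u * y u ∂l := by
        rw [e₄, integral_add_measure (hF₁.add_measure hF₂) hF₃, integral_add_measure hF₁ hF₂,
          e₁, e₂, e₃]
    _ = ∫ u, h u * x u ∂l := by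
        rw [add_zero, ← sub_eq_add_neg, ← integral_sub (hhi hd.pos_part) (hhi hd'.pos_part),
          ← integral_add (by exact (hhi hd.pos_part).sub (hhi hd'.pos_part)) (hhi hyi)]
        congr 1
        ext u
        have : max (x u - y u) 0 - max (y u - x u) 0 = x u - y u := by
          rcases le_total (x u) (y u) with hu | hu
          · rw [max_eq_right (by linarith), max_eq_left (by linarith)]; ring
          · rw [max_eq_left (by linarith), max_eq_right (by linarith)]; ring
        linear_combination (h u) * this
    _ = ∫ u in A, x u ∂l := by
        rw [← integral_indicator hA]
        refine integral_congr_ae (ae_of_all _ fun p => ?_)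
        by_cases hp : p ∈ A <;> simp [hh, hp]

theorem withDensity_neg_le_of_setIntegral_nonneg {E : Type*} [MeasurableSpace E] {l : Measure E}
    {f : E → ℝ} (hf : Integrable f l) {A : Set E} (hA : MeasurableSet A)
    (h : 0 ≤ ∫ u in A, f u ∂l) :
    l.withDensity (fun u => ENNReal.ofReal (-f u)) A ≤
      l.withDensity (fun u => ENNReal.ofReal (f u)) A := by
  rw [withDensity_apply _ hA, withDensity_apply _ hA]
  have hfA : Integrable f (l.restrict A) := hf.restrict
  rw [integral_eq_lintegral_pos_part_sub_lintegral_neg_part hfA, sub_nonneg] at h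
  exact (ENNReal.toReal_le_toReal hfA.neg.lintegral_lt_top.ne hfA.lintegral_lt_top.ne).1 h

/-- Strassen's theorem on the real line: measures in convex order admit a martingale coupling. -/
theorem exists_martingale_coupling (μ ν : Measure ℝ) [IsProbabilityMeasure μ]
    [IsProbabilityMeasure ν] (hμ : Integrable id μ) (hν : Integrable id ν)
    (hmean : ∫ z, z ∂ν = ∫ z, z ∂μ)
    (hcx : ∀ s : ℝ, ∫ z, max (s - z) 0 ∂μ ≤ ∫ z, max (s - z) 0 ∂ν) :
    ∃ γ : Measure (ℝ × ℝ), γ.map Prod.fst = μ ∧ γ.map Prod.snd = ν ∧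
      ∀ A, MeasurableSet A → ∫ p in Prod.fst ⁻¹' A, p.2 ∂γ = ∫ z in A, z ∂μ := by
  obtain ⟨x, hxm, hx⟩ := exists_quantile μ
  obtain ⟨y, hym, hy⟩ := exists_quantile ν
  set l : Measure ℝ := volume.restrict (Set.Ioo 0 1) with hl
  have hxl : l.map x = μ := map_quantile_s6 hxm hx
  have hyl : l.map y = ν := map_quantile_s6 hym hy
  have hmono : ∀ {η : Measure ℝ} {g : ℝ → ℝ},
      (∀ p ∈ Set.Ioo (0 : ℝ) 1, ∀ x, g p ≤ x ↔ p ≤ cdf η x) → MonotoneOn g (Set.Ioo 0 1) :=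
    fun hg a ha b hb hab => (hg a ha _).2 (hab.trans ((hg b hb _).1 le_rfl))
  have hxi : Integrable x l := Integrable.comp_measurable (g := id) (by rwa [hxl]) hxm
  have hyi : Integrable y l := Integrable.comp_measurable (g := id) (by rwa [hyl]) hym
  have hd : Integrable (fun u => x u - y u) l := hxi.sub hyi
  have htotal : ∫ u, (x u - y u) ∂l = 0 := by
    rw [integral_sub hxi hyi, sub_eq_zero, ← integral_map (f := fun z => z) hxm.aemeasurable
      (by fun_prop), ← integral_map (f := fun z => z) hym.aemeasurable (by fun_prop), hxl, hyl,
      hmean]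
  have hset : ∀ t, 0 ≤ ∫ u in Set.Iic t, (x u - y u) ∂l := by
    intro t
    rcases le_or_gt t 0 with ht | ht
    · have : Set.Iic t ∩ Set.Ioo (0 : ℝ) 1 = ∅ := by
        ext u
        simp only [Set.mem_inter_iff, Set.mem_Iic, Set.mem_Ioo, Set.mem_empty_iff_false]
        constructor
        · rintro ⟨h1, h2, -⟩
          linarith
        · exact False.elim
      rw [hl, Measure.restrict_restrict measurableSet_Iic, this]
      simp
    rcases le_or_gt 1 t with ht1 | ht1
    · have : Set.Iic t ∩ Set.Ioo (0 : ℝ) 1 = Set.Ioo 0 1 :=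
        Set.inter_eq_right.2 fun u hu => hu.2.le.trans ht1
      rw [hl, Measure.restrict_restrict measurableSet_Iic, this, ← hl, htotal]
    have htmem : t ∈ Set.Ioo (0 : ℝ) 1 := ⟨ht, ht1⟩
    have hsx : Integrable (fun u => y t - x u) l := (integrable_const _).sub hxi
    have hsy : Integrable (fun u => y t - y u) l := (integrable_const _).sub hyi
    have h1 : ∫ u in Set.Iic t, (y t - y u) ∂l = ∫ u, max (y t - y u) 0 ∂l := by
      rw [← integral_indicator measurableSet_Iic]
      refine integral_congr_ae ?_
      filter_upwards [ae_restrict_mem measurableSet_Ioo] with u hu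
      rcases le_or_gt u t with hut | hut
      · have := hmono hy hu htmem hut
        rw [Set.indicator_of_mem (by exact hut), max_eq_left (by linarith)]
      · have := hmono hy htmem hu hut.le
        rw [Set.indicator_of_notMem (by exact not_le.2 hut), max_eq_right (by linarith)]
    have h2 : ∫ u in Set.Iic t, (y t - x u) ∂l ≤ ∫ u, max (y t - x u) 0 ∂l :=
      (integral_mono hsx.restrict hsx.pos_part.restrict fun u => le_max_left _ _).trans
        (setIntegral_le_integral hsx.pos_part (ae_of_all _ fun u => le_max_right _ _))
    have h3 : ∫ u, max (y t - x u) 0 ∂l ≤ ∫ u, max (y t - y u) 0 ∂l := by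
      have := hcx (y t)
      rwa [← hxl, integral_map hxm.aemeasurable (by fun_prop), ← hyl,
        integral_map hym.aemeasurable (by fun_prop)] at this
    have h4 : ∫ u in Set.Iic t, (x u - y u) ∂l
        = ∫ u in Set.Iic t, (y t - y u) ∂l - ∫ u in Set.Iic t, (y t - x u) ∂l := by
      rw [← integral_sub hsy.restrict hsx.restrict]
      congr 1
      ext u
      ring
    linarith
  have hneg : (fun u => ENNReal.ofReal (-(x u - y u))) = fun u => ENNReal.ofReal (y u - x u) := by
    simp only [neg_sub]
  have hneg' : (fun u => ENNReal.ofReal (-(y u - x u))) = fun u => ENNReal.ofReal (x u - y u) := by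
    simp only [neg_sub]
  have hd' : Integrable (fun u => y u - x u) l := hyi.sub hxi
  have hf₁ := isFiniteMeasure_withDensity_ofReal hd.2
  have hf₂ := isFiniteMeasure_withDensity_ofReal hd'.2
  obtain ⟨α, hα₁, hα₂, hα⟩ := exists_monotone_coupling_s6
    (l.withDensity fun u => ENNReal.ofReal (x u - y u))
    (l.withDensity fun u => ENNReal.ofReal (y u - x u))
    (le_antisymm
      (hneg' ▸ withDensity_neg_le_of_setIntegral_nonneg hd' MeasurableSet.univ (by
        have : ∫ u, (y u - x u) ∂l = 0 := by
          rw [← neg_zero, ← htotal, ← integral_neg]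
          simp only [neg_sub]
        rw [setIntegral_univ, this]))
      (hneg ▸ withDensity_neg_le_of_setIntegral_nonneg hd MeasurableSet.univ (by
        rw [setIntegral_univ, htotal])))
    (fun t => hneg ▸ withDensity_neg_le_of_setIntegral_nonneg hd measurableSet_Iic (hset t))
  have hmem₁ : ∀ᵐ p ∂α, p.1 ∈ Set.Ioo (0 : ℝ) 1 := by
    refine ae_of_ae_map (p := fun u => u ∈ Set.Ioo (0 : ℝ) 1) measurable_fst.aemeasurable ?_
    rw [hα₁]
    exact (withDensity_absolutelyContinuous _ _).ae_le (ae_restrict_mem measurableSet_Ioo)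
  have hmem₂ : ∀ᵐ p ∂α, p.2 ∈ Set.Ioo (0 : ℝ) 1 := by
    refine ae_of_ae_map (p := fun u => u ∈ Set.Ioo (0 : ℝ) 1) measurable_snd.aemeasurable ?_
    rw [hα₂]
    exact (withDensity_absolutelyContinuous _ _).ae_le (ae_restrict_mem measurableSet_Ioo)
  obtain ⟨π, hπ₁, hπ₂, hπ⟩ := exists_symmetric_transport l hxm hym hxi hyi α hα₁ hα₂ (by
    filter_upwards [hα, hmem₁, hmem₂] with p h h1 h2 using hmono hx h1 h2 h)
  have hxym : Measurable (Prod.map x y) := hxm.prodMap hym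
  refine ⟨π.map (Prod.map x y), ?_, ?_, fun A hA => ?_⟩
  · rw [Measure.map_map measurable_fst hxym]
    change Measure.map (x ∘ Prod.fst) π = μ
    rw [← Measure.map_map hxm measurable_fst, hπ₁, hxl]
  · rw [Measure.map_map measurable_snd hxym]
    change Measure.map (y ∘ Prod.snd) π = ν
    rw [← Measure.map_map hym measurable_snd, hπ₂, hyl]
  · rw [setIntegral_map (measurable_fst hA) (by fun_prop) hxym.aemeasurable, ← hxl,
      setIntegral_map hA (by fun_prop) hxm.aemeasurable]
    exact hπ (x ⁻¹' A) (hxm hA)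

/-- Realizing a pair `(X, Y)` on top of a coupling whose second marginal is the law of `X`. -/
theorem map_compProd_comap_condDistrib {Ω : Type*} [MeasurableSpace Ω] {P : Measure Ω}
    [IsProbabilityMeasure P] {X Y : Ω → ℝ} (hY : Measurable Y)
    {γ : Measure (ℝ × ℝ)} [IsProbabilityMeasure γ] (hγ : γ.map Prod.snd = P.map X) :
    (γ ⊗ₘ (condDistrib Y X P).comap Prod.snd measurable_snd).map (fun w => (w.1.2, w.2)) =
      P.map fun ω => (X ω, Y ω) := by
  rw [← compProd_map_condDistrib hY.aemeasurable, ← hγ]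
  ext s hs
  have hm : Measurable fun w : (ℝ × ℝ) × ℝ => (w.1.2, w.2) := by fun_prop
  rw [Measure.map_apply hm hs, Measure.compProd_apply (hm hs), Measure.compProd_apply hs,
    lintegral_map (Kernel.measurable_kernel_prodMk_left hs) measurable_snd]
  rfl

theorem exists_H0SOn {Ω : Type*} [MeasurableSpace Ω] {P₁ : Measure Ω} [IsProbabilityMeasure P₁]
    {Y : Ω → ℝ} (hYm : Measurable Y) {q : ℝ → ℝ → ℝ} (hqm : Measurable (Function.uncurry q))
    {μ : Measure ℝ} [IsProbabilityMeasure μ] (hμ : Integrable id μ) (c : ℝ)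
    (hqi : Integrable (fun ω => q (Y ω) c) P₁) (hc : ∫ ω, q (Y ω) c ∂P₁ = ∫ z, z ∂μ)
    (hcx : ∀ s : ℝ, ∫ z, max (s - z) 0 ∂μ ≤ ∫ ω, max (s - q (Y ω) c) 0 ∂P₁) :
    ∃ (Ω' : Type) (mΩ' : MeasurableSpace Ω') (P : @Measure Ω' mΩ'),
      @H0SOn Ω' mΩ' P q (P₁.map Y) μ := by
  have hqc : Measurable fun z => q z c := hqm.comp (measurable_id.prodMk measurable_const)
  have hXm : Measurable fun ω => q (Y ω) c := hqc.comp hYm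
  set X : Ω → ℝ := fun ω => q (Y ω) c
  have hν : IsProbabilityMeasure (P₁.map X) := Measure.isProbabilityMeasure_map hXm.aemeasurable
  obtain ⟨γ, hγ₁, hγ₂, hγ⟩ := exists_martingale_coupling μ (P₁.map X) hμ
    ((integrable_map_measure (by fun_prop) hXm.aemeasurable).2 hqi)
    (by rw [integral_map hXm.aemeasurable (by fun_prop), hc])
    (fun s => by
      rw [integral_map hXm.aemeasurable (by fun_prop)]
      exact hcx s)
  have hγp : IsProbabilityMeasure γ := by
    have : IsProbabilityMeasure (γ.map Prod.fst) := by rwa [hγ₁]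
    exact Measure.isProbabilityMeasure_of_map Prod.fst
  let P : Measure ((ℝ × ℝ) × ℝ) := γ ⊗ₘ (condDistrib Y X P₁).comap Prod.snd measurable_snd
  have hP : P.map (fun w => (w.1.2, w.2)) = P₁.map fun ω => (X ω, Y ω) :=
    map_compProd_comap_condDistrib hYm hγ₂
  have hPfst : P.map Prod.fst = γ := Measure.fst_compProd _ _
  have hψm : Measurable fun w : (ℝ × ℝ) × ℝ => w.1.1 := by fun_prop
  have hPψ : P.map (fun w => w.1.1) = μ := by
    rw [← hγ₁, ← hPfst, Measure.map_map measurable_fst measurable_fst]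
    rfl
  have hPY : P.map Prod.snd = P₁.map Y := by
    have := congrArg (Measure.map Prod.snd) hP
    rwa [Measure.map_map measurable_snd (by fun_prop),
      Measure.map_map measurable_snd (by fun_prop)] at this
  have hqX : ∀ᵐ w ∂P, q w.2 c = w.1.2 := by
    refine ae_of_ae_map (f := fun w : (ℝ × ℝ) × ℝ => (w.1.2, w.2))
      (p := fun z : ℝ × ℝ => q z.2 c = z.1)
      (by fun_prop) ?_
    rw [hP]
    exact (ae_map_iff (hXm.prodMk hYm).aemeasurable
      (measurableSet_eq_fun (hqc.comp measurable_snd) measurable_fst)).2 (ae_of_all _ fun ω => rfl)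
  have hψi : Integrable (fun w : (ℝ × ℝ) × ℝ => w.1.1) P :=
    Integrable.comp_measurable (g := id) (by rwa [hPψ]) hψm
  have hqi' : Integrable (fun w : (ℝ × ℝ) × ℝ => q w.2 c) P :=
    Integrable.comp_measurable (g := fun z => q z c)
      (by rw [hPY]; exact (integrable_map_measure (by fun_prop) hYm.aemeasurable).2 hqi)
      measurable_snd
  refine ⟨(ℝ × ℝ) × ℝ, inferInstance, P, inferInstance, Prod.snd, fun w => w.1.1,
    measurable_snd, hψm, hPY, hPψ, MeasurableSpace.comap (fun w => w.1.1) Real.measurableSpace, c,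
    hψm.comap_le, le_rfl, ?_⟩
  refine (ae_eq_condExp_of_forall_setIntegral_eq hψm.comap_le hqi'
    (fun s _ _ => hψi.integrableOn) ?_ ?_).symm
  · rintro s ⟨A, hA, rfl⟩ -
    calc ∫ w in (fun w : (ℝ × ℝ) × ℝ => w.1.1) ⁻¹' A, w.1.1 ∂P = ∫ z in A, z ∂μ := by
          rw [← hPψ, setIntegral_map hA (by fun_prop) hψm.aemeasurable]
      _ = ∫ p in Prod.fst ⁻¹' A, p.2 ∂γ := (hγ A hA).symm
      _ = ∫ w in (fun w : (ℝ × ℝ) × ℝ => w.1.1) ⁻¹' A, w.1.2 ∂P := by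
          rw [← hPfst, setIntegral_map (measurable_fst hA) (by fun_prop)
            measurable_fst.aemeasurable]
          rfl
      _ = _ := by
          refine integral_congr_ae (ae_restrict_of_ae ?_)
          filter_upwards [hqX] with w hw using hw.symm
  · exact (comap_measurable _).aestronglyMeasurable

/-- Jensen's inequality for `z ↦ (s - z)⁺` and a conditional expectation. -/
theorem integral_max_sub_condExp_le {Ω : Type*} {m mΩ : MeasurableSpace Ω} {P : Measure Ω}
    [IsProbabilityMeasure P] (hm : m ≤ mΩ) {X Z : Ω → ℝ} (hX : Integrable X P)
    (hZm : Measurable[m] Z) (hZ : P[X | m] =ᵐ[P] Z) (s : ℝ) :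
    ∫ ω, max (s - Z ω) 0 ∂P ≤ ∫ ω, max (s - X ω) 0 ∂P := by
  have hA : MeasurableSet[m] (Z ⁻¹' Set.Iic s) := hZm measurableSet_Iic
  have hZi : Integrable Z P := integrable_condExp.congr hZ
  have hsX : Integrable (fun ω => s - X ω) P := (integrable_const _).sub hX
  have hcond : ∫ ω in Z ⁻¹' Set.Iic s, Z ω ∂P = ∫ ω in Z ⁻¹' Set.Iic s, X ω ∂P := by
    rw [← setIntegral_condExp hm hX hA]
    exact integral_congr_ae (ae_restrict_of_ae hZ.symm)
  calc ∫ ω, max (s - Z ω) 0 ∂P = ∫ ω in Z ⁻¹' Set.Iic s, (s - Z ω) ∂P := by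
        rw [← integral_indicator (hm _ hA)]
        refine integral_congr_ae (ae_of_all _ fun ω => ?_)
        by_cases h : Z ω ≤ s
        · simp [h]
        · simp [h, (not_le.1 h).le]
    _ = ∫ ω in Z ⁻¹' Set.Iic s, (s - X ω) ∂P := by
        rw [integral_sub (integrable_const _) hZi.restrict,
          integral_sub (integrable_const _) hX.restrict, hcond]
    _ ≤ ∫ ω in Z ⁻¹' Set.Iic s, max (s - X ω) 0 ∂P :=
        integral_mono hsX.restrict hsX.pos_part.restrict fun ω => le_max_left _ _
    _ ≤ _ := setIntegral_le_integral hsX.pos_part (ae_of_all _ fun ω => le_max_right _ _)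

/-- Proposition 3 of the paper: in the presence of aggregate shocks, H₀S holds if and only if
`E[(y - q(Y, c₀))⁺ - (y - ψ)⁺] ≥ 0` for all `y ∈ ℝ`, where `c₀` is the unique solution of
`E[q(Y, c)] = E[ψ]`. -/
theorem H0S_iff_moment_inequalities
    {Ω₁ Ω₂ : Type} [MeasurableSpace Ω₁] [MeasurableSpace Ω₂]
    (P₁ : Measure Ω₁) (P₂ : Measure Ω₂)
    [IsProbabilityMeasure P₁] [IsProbabilityMeasure P₂]
    {Y : Ω₁ → ℝ} {ψ : Ω₂ → ℝ}
    (hYm : Measurable Y) (hψm : Measurable ψ)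
    (q : ℝ → ℝ → ℝ) (hqm : Measurable (Function.uncurry q))
    (hψi : Integrable ψ P₂)
    (hqi : ∀ c : ℝ, Integrable (fun ω => q (Y ω) c) P₁)
    (c₀ : ℝ) (hc₀ : ∫ ω, q (Y ω) c₀ ∂P₁ = ∫ ω, ψ ω ∂P₂)
    (hc₀uniq : ∀ c : ℝ, ∫ ω, q (Y ω) c ∂P₁ = ∫ ω, ψ ω ∂P₂ → c = c₀) :
    (∃ (Ω : Type) (mΩ : MeasurableSpace Ω) (P : @Measure Ω mΩ),
        @H0SOn Ω mΩ P q (P₁.map Y) (P₂.map ψ)) ↔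
      ∀ y : ℝ, ∫ ω, max (y - ψ ω) 0 ∂P₂ ≤ ∫ ω, max (y - q (Y ω) c₀) 0 ∂P₁ := by
  have hqc : ∀ c, Measurable fun z => q z c := fun c =>
    hqm.comp (measurable_id.prodMk measurable_const)
  constructor
  · rintro ⟨Ω, mΩ, P, hP, Y', ψ', hY', hψ', hYlaw, hψlaw, I', c, hI, hψI, hcond⟩ s
    have hqi' : Integrable (fun ω => q (Y' ω) c) P :=
      Integrable.comp_measurable (g := fun z => q z c)
        (by rw [hYlaw]
            exact (integrable_map_measure (hqc c).aestronglyMeasurable hYm.aemeasurable).2 (hqi c))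
        hY'
    have htransfer : ∀ {f : ℝ → ℝ}, Measurable f →
        ∫ ω, f (Y' ω) ∂P = ∫ ω, f (Y ω) ∂P₁ := fun {f} hf => by
      rw [← integral_map hY'.aemeasurable hf.aestronglyMeasurable, hYlaw,
        integral_map hYm.aemeasurable hf.aestronglyMeasurable]
    have htransfer' : ∀ {f : ℝ → ℝ}, Measurable f →
        ∫ ω, f (ψ' ω) ∂P = ∫ ω, f (ψ ω) ∂P₂ := fun {f} hf => by
      rw [← integral_map hψ'.aemeasurable hf.aestronglyMeasurable, hψlaw,
        integral_map hψm.aemeasurable hf.aestronglyMeasurable]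
    obtain rfl : c = c₀ := hc₀uniq c <| by
      rw [← htransfer (hqc c), ← integral_condExp hI, integral_congr_ae hcond]
      exact htransfer' measurable_id
    rw [← htransfer' (f := fun z => max (s - z) 0) (by fun_prop),
      ← htransfer (f := fun z => max (s - q z c) 0)
        ((measurable_const.sub (hqc c)).max measurable_const)]
    exact integral_max_sub_condExp_le hI hqi' (measurable_iff_comap_le.2 hψI) hcond s
  · intro h
    have : IsProbabilityMeasure (P₂.map ψ) := Measure.isProbabilityMeasure_map hψm.aemeasurable
    refine exists_H0SOn hYm hqm
      ((integrable_map_measure (by fun_prop) hψm.aemeasurable).2 hψi) c₀ (hqi c₀) ?_ fun s => ?_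
    · rw [hc₀, integral_map hψm.aemeasurable (by fun_prop)]
    · rw [integral_map hψm.aemeasurable (by fun_prop)]
      exact h s
end
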